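/- arXiv:2312.05914 — 2 statements merged into one kernel-verified Lean document; each statement's English description precedes it below -/
import Mathlib

section
/- Let R be a commutative Noetherian local ring of Krull dimension d, C a semidualizing R-module, and M, N nonzero finitely generated R-modules such that N belongs to the Auslander class A_C(R) and N is maximal Cohen-Macaulay. Suppose that Hom_R(M,N) has finite C-injective dimension and that Ext_R^i(M,N) = 0 for all 1 ≤ i ≤ d. Then R is Cohen-Macaulay, M is free, and N has finite C-injective dimension. -/
open CategoryTheory

noncomputable section

/-- The `i`-th Ext module of two `R`-modules. -/
def extMod (R : Type) [CommRing R] (i : ℕ) (M N : Type) [AddCommGroup M] [Module R M]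
    [AddCommGroup N] [Module R N] : ModuleCat R :=
  ((Ext R (ModuleCat R) i).obj (Opposite.op (ModuleCat.of R M))).obj (ModuleCat.of R N)

/-- The `i`-th Tor module of two `R`-modules. -/
def torMod (R : Type) [CommRing R] (i : ℕ) (M N : Type) [AddCommGroup M] [Module R M]
    [AddCommGroup N] [Module R N] : ModuleCat R :=
  ((Tor (ModuleCat R) i).obj (ModuleCat.of R M)).obj (ModuleCat.of R N)

/-- The depth of a module over a local ring: the infimum of the set of
indices `i` with `Ext^i(R/𝔪, N) ≠ 0`. -/
def moduleDepth (R : Type) [CommRing R] [IsLocalRing R] (N : Type) [AddCommGroup N]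
    [Module R N] : ℕ :=
  sInf {i : ℕ | ¬ Subsingleton (extMod R i (R ⧸ IsLocalRing.maximalIdeal R) N)}

/-- An `R`-module `N` has finite injective dimension iff there is an `n` such that
`Ext^i(M, N) = 0` for all modules `M` and all `i > n`. -/
def HasFiniteInjDim (R : Type) [CommRing R] (N : Type) [AddCommGroup N] [Module R N] : Prop :=
  ∃ n : ℕ, ∀ (M : Type) [AddCommGroup M] [Module R M], ∀ i : ℕ, n < i →
    Subsingleton (extMod R i M N)

/-- An `R`-module `M` has finite projective dimension iff there is an `n` such that
`Ext^i(M, N) = 0` for all modules `N` and all `i > n`. -/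
def HasFiniteProjDim (R : Type) [CommRing R] (M : Type) [AddCommGroup M] [Module R M] : Prop :=
  ∃ n : ℕ, ∀ (N : Type) [AddCommGroup N] [Module R N], ∀ i : ℕ, n < i →
    Subsingleton (extMod R i M N)

/-- The `𝔪`-torsion submodule `Γ_𝔪(M)` of a module over a local ring. -/
def mTorsion (R : Type) [CommRing R] [IsLocalRing R] (M : Type) [AddCommGroup M]
    [Module R M] : Submodule R M :=
  ⨆ n : ℕ, Submodule.torsionBySet R M ((IsLocalRing.maximalIdeal R ^ n : Ideal R) : Set R)

/-- A semidualizing module: the natural map `R → Hom(C,C)` is bijective and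
`Ext^i(C,C) = 0` for all `i ≥ 1`. -/
structure IsSemidualizing (R : Type) [CommRing R] (C : Type) [AddCommGroup C]
    [Module R C] : Prop where
  bijective : Function.Bijective (LinearMap.lsmul R C)
  ext_vanish : ∀ i : ℕ, 1 ≤ i → Subsingleton (extMod R i C C)

/-- Membership in the Auslander class `A_C(R)`: the natural map `M → Hom(C, C ⊗ M)` is
bijective, `Tor_i(C, M) = 0` and `Ext^i(C, C ⊗ M) = 0` for all `i ≥ 1`. -/
structure MemAuslanderClass (R : Type) [CommRing R] (C : Type) [AddCommGroup C] [Module R C]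
    (M : Type) [AddCommGroup M] [Module R M] : Prop where
  bijective : Function.Bijective ((TensorProduct.mk R C M).flip)
  tor_vanish : ∀ i : ℕ, 1 ≤ i → Subsingleton (torMod R i C M)
  ext_vanish : ∀ i : ℕ, 1 ≤ i → Subsingleton (extMod R i C (TensorProduct R C M))

/-- A module `N` is Tor-rigid if for every finitely generated module `M` and every `i ≥ 1`,
`Tor_i(M, N) = 0` implies `Tor_{i+1}(M, N) = 0`. -/
def IsTorRigid (R : Type) [CommRing R] (N : Type) [AddCommGroup N] [Module R N] : Prop :=
  ∀ (M : Type) [AddCommGroup M] [Module R M], Module.Finite R M →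
    ∀ i : ℕ, 1 ≤ i → Subsingleton (torMod R i M N) → Subsingleton (torMod R (i + 1) M N)

/-- The natural map `C ⊗ Hom(M,N) → Hom(M, C ⊗ N)`, sending `c ⊗ φ` to `m ↦ c ⊗ φ m`. -/
def homTensorMap (R : Type) [CommRing R] (C M N : Type) [AddCommGroup C] [Module R C]
    [AddCommGroup M] [Module R M] [AddCommGroup N] [Module R N] :
    TensorProduct R C (M →ₗ[R] N) →ₗ[R] (M →ₗ[R] TensorProduct R C N) :=
  TensorProduct.lift
    ((LinearMap.llcomp R M N (TensorProduct R C N)).comp (TensorProduct.mk R C N))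

universe u

/-- `ExtZero R A B n` says that `Ext^n_R(A, B) = 0`. -/
def ExtZero (R : Type u) [CommRing R] (A B : Type u) [AddCommGroup A] [Module R A]
    [AddCommGroup B] [Module R B] (n : ℕ) : Prop :=
  Subsingleton (Abelian.Ext (ModuleCat.of R A) (ModuleCat.of R B) n)

/-- A short exact sequence of modules. -/
structure IsSES {R : Type u} [CommRing R] {A B D : Type u} [AddCommGroup A] [Module R A]
    [AddCommGroup B] [Module R B] [AddCommGroup D] [Module R D]
    (f : A →ₗ[R] B) (g : B →ₗ[R] D) : Prop where
  inj : Function.Injective f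
  exact : Function.Exact f g
  surj : Function.Surjective g

section ExtApi

variable {R : Type u} [CommRing R] {A B D W A' B' D' : Type u}
  [AddCommGroup A] [Module R A] [AddCommGroup B] [Module R B] [AddCommGroup D] [Module R D]
  [AddCommGroup W] [Module R W]
  [AddCommGroup A'] [Module R A'] [AddCommGroup B'] [Module R B'] [AddCommGroup D'] [Module R D']

variable (W) in
/-- The map `Ext^n(W, A) → Ext^n(W, B)` induced by `f : A → B`. -/
def extCov (f : A →ₗ[R] B) (n : ℕ) :
    Abelian.Ext (ModuleCat.of R W) (ModuleCat.of R A) n →ₗ[R]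
      Abelian.Ext (ModuleCat.of R W) (ModuleCat.of R B) n where
  toFun e := e.comp (Abelian.Ext.mk₀ (ModuleCat.ofHom f)) (add_zero n)
  map_add' := by simp
  map_smul' := by simp

variable (W) in
/-- The map `Ext^n(B, W) → Ext^n(A, W)` induced by `f : A → B`. -/
def extCon (f : A →ₗ[R] B) (n : ℕ) :
    Abelian.Ext (ModuleCat.of R B) (ModuleCat.of R W) n →ₗ[R]
      Abelian.Ext (ModuleCat.of R A) (ModuleCat.of R W) n where
  toFun e := (Abelian.Ext.mk₀ (ModuleCat.ofHom f)).comp e (zero_add n)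
  map_add' := by simp
  map_smul' := by simp

lemma extCov_comp (f : A →ₗ[R] B) (g : B →ₗ[R] D) (n : ℕ)
    (e : Abelian.Ext (ModuleCat.of R W) (ModuleCat.of R A) n) :
    extCov W (g ∘ₗ f) n e = extCov W g n (extCov W f n e) := by
  simp [extCov, ModuleCat.ofHom_comp]

lemma extCov_id (n : ℕ) (e : Abelian.Ext (ModuleCat.of R W) (ModuleCat.of R A) n) :
    extCov W LinearMap.id n e = e := by
  change e.comp (Abelian.Ext.mk₀ (𝟙 _)) (add_zero n) = e
  simp

lemma extCov_add (f g : A →ₗ[R] B) (n : ℕ) :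
    extCov W (f + g) n = extCov W f n + extCov W g n := by
  ext e
  change e.comp (Abelian.Ext.mk₀ (ModuleCat.ofHom f + ModuleCat.ofHom g)) (add_zero n) =
    extCov W f n e + extCov W g n e
  rw [Abelian.Ext.mk₀_add, Abelian.Ext.comp_add]
  rfl

lemma extCov_smul (r : R) (f : A →ₗ[R] B) (n : ℕ) :
    extCov W (r • f) n = r • extCov W f n := by
  ext e
  change e.comp (Abelian.Ext.mk₀ (r • ModuleCat.ofHom f)) (add_zero n) = r • extCov W f n e
  simp [extCov, Abelian.Ext.mk₀_smul]

lemma extCov_zero (n : ℕ) : extCov W (0 : A →ₗ[R] B) n = 0 := by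
  simpa using extCov_smul (W := W) (0 : R) (0 : A →ₗ[R] B) n

lemma extCov_sum {ι : Type*} (s : Finset ι) (f : ι → A →ₗ[R] B) (n : ℕ) :
    extCov W (∑ i ∈ s, f i) n = ∑ i ∈ s, extCov W (f i) n := by
  classical
  induction s using Finset.induction_on with
  | empty => simp [extCov_zero]
  | insert a s ha ih => rw [Finset.sum_insert ha, Finset.sum_insert ha, extCov_add, ih]

lemma extCov_smul_id (r : R) (n : ℕ) (e : Abelian.Ext (ModuleCat.of R W) (ModuleCat.of R A) n) :
    extCov W (LinearMap.lsmul R A r) n e = r • e := by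
  have : LinearMap.lsmul R A r = r • LinearMap.id := rfl
  rw [this, extCov_smul, LinearMap.smul_apply, extCov_id]

lemma extCon_comp (f : A →ₗ[R] B) (g : B →ₗ[R] D) (n : ℕ)
    (e : Abelian.Ext (ModuleCat.of R D) (ModuleCat.of R W) n) :
    extCon W (g ∘ₗ f) n e = extCon W f n (extCon W g n e) := by
  simp [extCon, ModuleCat.ofHom_comp]

lemma extCon_id (n : ℕ) (e : Abelian.Ext (ModuleCat.of R A) (ModuleCat.of R W) n) :
    extCon W LinearMap.id n e = e := by
  change (Abelian.Ext.mk₀ (𝟙 _)).comp e (zero_add n) = e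
  simp

lemma extCon_zero (n : ℕ) : extCon W (0 : A →ₗ[R] B) n = 0 := by
  ext e
  change (Abelian.Ext.mk₀ (0 : ModuleCat.of R A ⟶ ModuleCat.of R B)).comp e (zero_add n) = 0
  simp

lemma extCon_add (f g : A →ₗ[R] B) (n : ℕ) :
    extCon W (f + g) n = extCon W f n + extCon W g n := by
  ext e
  change (Abelian.Ext.mk₀ (ModuleCat.ofHom f + ModuleCat.ofHom g)).comp e (zero_add n) =
    extCon W f n e + extCon W g n e
  rw [Abelian.Ext.mk₀_add, Abelian.Ext.add_comp]
  rfl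

lemma extCon_smul (r : R) (f : A →ₗ[R] B) (n : ℕ) :
    extCon W (r • f) n = r • extCon W f n := by
  ext e
  change (Abelian.Ext.mk₀ (r • ModuleCat.ofHom f)).comp e (zero_add n) = r • extCon W f n e
  simp [extCon, Abelian.Ext.mk₀_smul]

lemma extCon_sum {ι : Type*} (s : Finset ι) (f : ι → A →ₗ[R] B) (n : ℕ) :
    extCon W (∑ i ∈ s, f i) n = ∑ i ∈ s, extCon W (f i) n := by
  classical
  induction s using Finset.induction_on with
  | empty => simp [extCon_zero]
  | insert a s ha ih => rw [Finset.sum_insert ha, Finset.sum_insert ha, extCon_add, ih]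

lemma extCon_smul_id (r : R) (n : ℕ) (e : Abelian.Ext (ModuleCat.of R A) (ModuleCat.of R W) n) :
    extCon W (LinearMap.lsmul R A r) n e = r • e := by
  have : LinearMap.lsmul R A r = r • LinearMap.id := rfl
  rw [this, extCon_smul, LinearMap.smul_apply, extCon_id]

namespace IsSES

/-- The short complex attached to a short exact sequence of modules. -/
abbrev sc {f : A →ₗ[R] B} {g : B →ₗ[R] D} (h : IsSES f g) : ShortComplex (ModuleCat.{u} R) :=
  ModuleCat.shortComplexOfCompEqZero f g h.exact.linearMap_comp_eq_zero

lemma shortExact {f : A →ₗ[R] B} {g : B →ₗ[R] D} (h : IsSES f g) : h.sc.ShortExact where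
  exact := ModuleCat.shortComplex_exact _ h.exact
  mono_f := (ModuleCat.mono_iff_injective _).mpr h.inj
  epi_g := (ModuleCat.epi_iff_surjective _).mpr h.surj

variable {f : A →ₗ[R] B} {g : B →ₗ[R] D} (h : IsSES f g)

variable (W) in
/-- The connecting map `Ext^n(W, D) → Ext^{n+1}(W, A)`. -/
def covδ (n : ℕ) (e : Abelian.Ext (ModuleCat.of R W) (ModuleCat.of R D) n) :
    Abelian.Ext (ModuleCat.of R W) (ModuleCat.of R A) (n + 1) :=
  e.comp h.shortExact.extClass rfl

lemma covδ_zero (n : ℕ) : h.covδ W n 0 = 0 := by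
  simp [covδ]

lemma covδ_sub (n : ℕ) (e e' : Abelian.Ext (ModuleCat.of R W) (ModuleCat.of R D) n) :
    h.covδ W n (e - e') = h.covδ W n e - h.covδ W n e' := by
  simp [covδ, sub_eq_add_neg]

include h in
lemma cov_exact₂ (n : ℕ) (e : Abelian.Ext (ModuleCat.of R W) (ModuleCat.of R B) n)
    (he : extCov W g n e = 0) : ∃ e', extCov W f n e' = e :=
  Abelian.Ext.covariant_sequence_exact₂ (ModuleCat.of R W) h.shortExact e he

lemma cov_exact₁ (n : ℕ) (e : Abelian.Ext (ModuleCat.of R W) (ModuleCat.of R A) (n + 1))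
    (he : extCov W f (n + 1) e = 0) : ∃ e', h.covδ W n e' = e :=
  Abelian.Ext.covariant_sequence_exact₁ (ModuleCat.of R W) h.shortExact e he rfl

lemma cov_exact₃ (n : ℕ) (e : Abelian.Ext (ModuleCat.of R W) (ModuleCat.of R D) n)
    (he : h.covδ W n e = 0) : ∃ e', extCov W g n e' = e :=
  Abelian.Ext.covariant_sequence_exact₃ (ModuleCat.of R W) h.shortExact e rfl he

include h in
lemma con_exact₂ (n : ℕ) (e : Abelian.Ext (ModuleCat.of R B) (ModuleCat.of R W) n)
    (he : extCon W f n e = 0) : ∃ e', extCon W g n e' = e :=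
  Abelian.Ext.contravariant_sequence_exact₂ h.shortExact (ModuleCat.of R W) e he

include h in
lemma con_surjective (n : ℕ) (hD : ExtZero R D W (n + 1)) :
    Function.Surjective (extCon W f n) := fun e =>
  Abelian.Ext.contravariant_sequence_exact₁ h.shortExact (ModuleCat.of R W) e (add_comm 1 n)
    (@Subsingleton.elim _ hD _ _)

include h in
lemma con_injective (n : ℕ) (hA : ExtZero R A W n) :
    Function.Injective (extCon W g (n + 1)) := by
  rw [injective_iff_map_eq_zero]
  intro e he
  obtain ⟨e', rfl⟩ := Abelian.Ext.contravariant_sequence_exact₃ h.shortExact (ModuleCat.of R W) e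
    he (add_comm 1 n)
  rw [@Subsingleton.elim _ hA e' 0, Abelian.Ext.comp_zero]

include h in
lemma cov_surjective (n : ℕ) (hA : ExtZero R W A (n + 1)) :
    Function.Surjective (extCov W g n) := fun e =>
  h.cov_exact₃ n e (@Subsingleton.elim _ hA _ _)

include h in
lemma cov₃ (n : ℕ) (hB : ExtZero R W B n) (hA : ExtZero R W A (n + 1)) : ExtZero R W D n := by
  refine subsingleton_of_forall_eq 0 fun e => ?_
  obtain ⟨e', rfl⟩ := h.cov_surjective n hA e
  rw [@Subsingleton.elim _ hB e' 0, map_zero]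

include h in
lemma con₁ (n : ℕ) (hB : ExtZero R B W n) (hD : ExtZero R D W (n + 1)) : ExtZero R A W n := by
  refine subsingleton_of_forall_eq 0 fun e => ?_
  obtain ⟨e', rfl⟩ := h.con_surjective n hD e
  rw [@Subsingleton.elim _ hB e' 0, map_zero]

include h in
lemma con₂ (n : ℕ) (hA : ExtZero R A W n) (hD : ExtZero R D W n) : ExtZero R B W n := by
  refine subsingleton_of_forall_eq 0 fun e => ?_
  obtain ⟨e', rfl⟩ := h.con_exact₂ n e (@Subsingleton.elim _ hA _ _)
  rw [@Subsingleton.elim _ hD e' 0, map_zero]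

include h in
lemma con₃ (n : ℕ) (hA : ExtZero R A W n) (hB : ExtZero R B W (n + 1)) :
    ExtZero R D W (n + 1) := by
  refine subsingleton_of_forall_eq 0 fun e => h.con_injective n hA ?_
  exact @Subsingleton.elim _ hB _ _

lemma covδ_naturality {f' : A' →ₗ[R] B'} {g' : B' →ₗ[R] D'} (h' : IsSES f' g')
    (a : A →ₗ[R] A') (b : B →ₗ[R] B') (d : D →ₗ[R] D')
    (hab : b ∘ₗ f = f' ∘ₗ a) (hbd : d ∘ₗ g = g' ∘ₗ b) (n : ℕ)
    (e : Abelian.Ext (ModuleCat.of R W) (ModuleCat.of R D) n) :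
    extCov W a (n + 1) (h.covδ W n e) = h'.covδ W n (extCov W d n e) := by
  let φ : h.sc ⟶ h'.sc :=
    { τ₁ := ModuleCat.ofHom a
      τ₂ := ModuleCat.ofHom b
      τ₃ := ModuleCat.ofHom d
      comm₁₂ := by
        ext x
        exact (LinearMap.congr_fun hab x).symm
      comm₂₃ := by
        ext x
        exact (LinearMap.congr_fun hbd x).symm }
  have := ShortComplex.ShortExact.extClass_naturality h.shortExact h'.shortExact φ
  change (e.comp h.shortExact.extClass rfl).comp (Abelian.Ext.mk₀ φ.τ₁) (add_zero _) =
    (e.comp (Abelian.Ext.mk₀ φ.τ₃) (add_zero _)).comp h'.shortExact.extClass rfl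
  rw [Abelian.Ext.comp_assoc_of_third_deg_zero, this, Abelian.Ext.comp_assoc_of_second_deg_zero]

end IsSES

lemma ExtZero.of_retract_right {n : ℕ} (i : A →ₗ[R] B) (p : B →ₗ[R] A) (hpi : p ∘ₗ i = .id)
    (h : ExtZero R W B n) : ExtZero R W A n := by
  refine subsingleton_of_forall_eq 0 fun e => ?_
  rw [← extCov_id n e, ← hpi, extCov_comp, @Subsingleton.elim _ h (extCov W i n e) 0, map_zero]

lemma ExtZero.of_retract_left {n : ℕ} (i : A →ₗ[R] B) (p : B →ₗ[R] A) (hpi : p ∘ₗ i = .id)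
    (h : ExtZero R B W n) : ExtZero R A W n := by
  refine subsingleton_of_forall_eq 0 fun e => ?_
  rw [← extCon_id n e, ← hpi, extCon_comp, @Subsingleton.elim _ h (extCon W p n e) 0, map_zero]

lemma ExtZero.congr_right {n : ℕ} (e : A ≃ₗ[R] B) (h : ExtZero R W B n) : ExtZero R W A n :=
  h.of_retract_right (e : A →ₗ[R] B) (e.symm : B →ₗ[R] A) (by ext; simp)

lemma ExtZero.congr_left {n : ℕ} (e : A ≃ₗ[R] B) (h : ExtZero R B W n) : ExtZero R A W n :=
  h.of_retract_left (e : A →ₗ[R] B) (e.symm : B →ₗ[R] A) (by ext; simp)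

lemma extZero_zero_iff : ExtZero R A B 0 ↔ Subsingleton (A →ₗ[R] B) :=
  (Abelian.Ext.addEquiv₀.trans ModuleCat.homAddEquiv).subsingleton_congr

lemma extZero_of_subsingleton_left [Subsingleton A] (n : ℕ) : ExtZero R A B n := by
  refine subsingleton_of_forall_eq 0 fun e => ?_
  rw [← extCon_id n e, show (LinearMap.id : A →ₗ[R] A) = 0 from Subsingleton.elim _ _,
    extCon_zero, LinearMap.zero_apply]

lemma extZero_succ_of_projective [Module.Projective R A] (n : ℕ) : ExtZero R A B (n + 1) := by
  have : Projective (ModuleCat.of R A) := (IsProjective.iff_projective A).mp inferInstance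
  exact Abelian.Ext.subsingleton_of_projective _ _ n

end ExtApi

section Bridge

variable {R : Type} [CommRing R] (A B : Type) [AddCommGroup A] [Module R A]
  [AddCommGroup B] [Module R B]

lemma subsingleton_extMod_iff_exists {A : ModuleCat.{0} R}
    (P : ProjectiveResolution A) (n : ℕ) :
    Subsingleton (extMod R n A B) ↔
      ∀ f : P.complex.X n ⟶ ModuleCat.of R B, P.complex.d (n + 1) n ≫ f = 0 →
        ∃ g : P.complex.X ((ComplexShape.up ℕ).prev n) ⟶ ModuleCat.of R B,
          P.complex.d n ((ComplexShape.up ℕ).prev n) ≫ g = f := by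
  rw [← ModuleCat.isZero_iff_subsingleton]
  have e : extMod R n A B ≅ _ := P.isoExt (R := R) n (ModuleCat.of R B)
  rw [e.isZero_iff, ← HomologicalComplex.exactAt_iff_isZero_homology,
    HomologicalComplex.exactAt_iff' _ _ n (n + 1) rfl (CochainComplex.next ℕ n),
    ShortComplex.moduleCat_exact_iff]
  rfl

lemma subsingleton_extMod_iff (n : ℕ) : Subsingleton (extMod R n A B) ↔ ExtZero R A B n := by
  have P : ProjectiveResolution (ModuleCat.of R A) := projectiveResolution _
  refine (subsingleton_extMod_iff_exists B P n).trans ?_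
  cases n with
  | zero =>
    rw [extZero_zero_iff, ← ModuleCat.homAddEquiv (M := ModuleCat.of R A)
      (N := ModuleCat.of R B) |>.subsingleton_congr]
    change _ ↔ Subsingleton
      (((ChainComplex.single₀ (ModuleCat R)).obj (ModuleCat.of R A)).X 0 ⟶ ModuleCat.of R B)
    constructor
    · intro h
      refine subsingleton_of_forall_eq 0 fun u => ?_
      obtain ⟨g, hg⟩ := h (P.π.f 0 ≫ u) (by
        rw [← Category.assoc, P.complex_d_comp_π_f_zero, Limits.zero_comp])
      rw [P.complex.shape 0 _ (by simp), Limits.zero_comp] at hg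
      rw [← cancel_epi (P.π.f 0), ← hg, Limits.comp_zero]
    · intro h f hf
      refine ⟨0, ?_⟩
      rw [Limits.comp_zero]
      have : f = P.π.f 0 ≫ P.exact₀.desc f hf := (P.exact₀.g_desc f hf).symm
      rw [this, h.elim (P.exact₀.desc f hf) 0]
      exact Limits.comp_zero.symm
  | succ n =>
    rw [CochainComplex.prev_nat_succ]
    constructor
    · intro h
      refine subsingleton_of_forall_eq 0 fun α => ?_
      obtain ⟨f, hf, rfl⟩ := P.extMk_surjective α (n + 2) rfl
      exact (P.extMk_eq_zero_iff f (n + 2) rfl hf n rfl).mpr (h f hf)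
    · intro h f hf
      exact (P.extMk_eq_zero_iff f (n + 2) rfl hf n rfl).mp (@Subsingleton.elim _ h _ _)

end Bridge

section Nakayama

open IsLocalRing
open scoped Pointwise

lemma smul_ext_eq_zero_of_left {R : Type u} [CommRing R] {A B : Type u} [AddCommGroup A]
    [Module R A] [AddCommGroup B] [Module R B] {r : R} (hr : ∀ a : A, r • a = 0) {n : ℕ}
    (e : Abelian.Ext (ModuleCat.of R A) (ModuleCat.of R B) n) : r • e = 0 := by
  rw [← extCon_smul_id, show LinearMap.lsmul R A r = 0 from LinearMap.ext hr, extCon_zero,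
    LinearMap.zero_apply]

lemma smul_ext_eq_zero_of_right {R : Type u} [CommRing R] {A B : Type u} [AddCommGroup A]
    [Module R A] [AddCommGroup B] [Module R B] {r : R} (hr : ∀ b : B, r • b = 0) {n : ℕ}
    (e : Abelian.Ext (ModuleCat.of R A) (ModuleCat.of R B) n) : r • e = 0 := by
  rw [← extCov_smul_id, show LinearMap.lsmul R B r = 0 from LinearMap.ext hr, extCov_zero,
    LinearMap.zero_apply]

variable {R : Type u} [CommRing R]

lemma isSES_of_isSMulRegular {P : Type u} [AddCommGroup P] [Module R P] {x : R}
    (hx : IsSMulRegular P x) :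
    IsSES (LinearMap.lsmul R P x) (x • (⊤ : Submodule R P)).mkQ where
  inj := hx
  exact := LinearMap.exact_lsmul_mkQ_smul_top P x
  surj := Submodule.mkQ_surjective _

lemma ExtZero.quotSMulTop {W P : Type u} [AddCommGroup W] [Module R W] [AddCommGroup P]
    [Module R P] {x : R} (hx : IsSMulRegular P x) {i : ℕ} (h : ExtZero R W P i)
    (h' : ExtZero R W P (i + 1)) : ExtZero R W (QuotSMulTop x P) i :=
  (isSES_of_isSMulRegular hx).cov₃ i h h'

lemma WithBot.eq_bot_of_add_one_le_zero {a : WithBot ℕ∞} (h : a + 1 ≤ 0) : a = ⊥ := by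
  induction a with
  | bot => rfl
  | coe a =>
    exfalso
    have : ((a + 1 : ℕ∞) : WithBot ℕ∞) ≤ ((0 : ℕ∞) : WithBot ℕ∞) := h
    rw [WithBot.coe_le_coe] at this
    simp at this

lemma WithBot.le_of_add_one_le_succ {a : WithBot ℕ∞} {n : ℕ} (h : a + 1 ≤ (n + 1 : ℕ)) :
    a ≤ n := by
  induction a with
  | bot => exact bot_le
  | coe a =>
    have : ((a + 1 : ℕ∞) : WithBot ℕ∞) ≤ (((n + 1 : ℕ) : ℕ∞) : WithBot ℕ∞) := h
    rw [WithBot.coe_le_coe] at this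
    push_cast at this
    refine WithBot.coe_le_coe.mpr ?_
    exact (ENat.add_le_add_iff_right (by simp)).mp this

variable [IsLocalRing R]

lemma subsingleton_of_forall_mem_smul_top {E : Type*} [AddCommGroup E] [Module R E]
    [Module.Finite R E] (h : ∀ e : E, e ∈ maximalIdeal R • (⊤ : Submodule R E)) :
    Subsingleton E := by
  rw [← Submodule.subsingleton_iff R, ← subsingleton_iff_bot_eq_top, eq_comm]
  exact Submodule.eq_bot_of_le_smul_of_le_jacobson_bot _ _ Module.Finite.fg_top
    (fun e _ => h e) (maximalIdeal_le_jacobson _)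

lemma subsingleton_of_smul_surjective {E : Type*} [AddCommGroup E] [Module R E]
    [Module.Finite R E] {x : R} (hx : x ∈ maximalIdeal R) (h : ∀ e : E, ∃ e', x • e' = e) :
    Subsingleton E := by
  refine subsingleton_of_forall_mem_smul_top (R := R) fun e => ?_
  obtain ⟨e', rfl⟩ := h e
  exact Submodule.smul_mem_smul hx trivial

lemma smul_residue_eq_zero {x : R} (hx : x ∈ maximalIdeal R) (a : R ⧸ maximalIdeal R) :
    x • a = 0 := by
  obtain ⟨a, rfl⟩ := Ideal.Quotient.mk_surjective a
  exact Ideal.Quotient.eq_zero_iff_mem.mpr (Ideal.mul_mem_right _ _ hx)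

lemma exists_isSMulRegular [IsNoetherianRing R] {P : Type u} [AddCommGroup P] [Module R P]
    [Module.Finite R P] (h : ExtZero R (R ⧸ maximalIdeal R) P 0) :
    ∃ x ∈ maximalIdeal R, IsSMulRegular P x := by
  obtain ⟨x, hx, hreg⟩ := IsSMulRegular.subsingleton_linearMap_iff.mp (extZero_zero_iff.mp h)
  exact ⟨x, by rwa [Ideal.annihilator_quotient] at hx, hreg⟩

lemma subsingleton_of_quotSMulTop {P : Type u} [AddCommGroup P] [Module R P]
    [Module.Finite R P] {x : R} (hx : x ∈ maximalIdeal R) (h : Subsingleton (QuotSMulTop x P)) :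
    Subsingleton P := by
  by_contra hP
  rw [not_subsingleton_iff_nontrivial] at hP
  exact not_subsingleton_iff_nontrivial.mpr
    (nontrivial_quotSMulTop_of_mem_maximalIdeal P hx) h

/-- A nonzero finitely generated module has depth at most its dimension. -/
lemma subsingleton_of_extZero_residue [IsNoetherianRing R] (n : ℕ) :
    ∀ (P : Type u) [AddCommGroup P] [Module R P] [Module.Finite R P],
      (∀ i ≤ n, ExtZero R (R ⧸ maximalIdeal R) P i) → Module.supportDim R P ≤ n →
      Subsingleton P := by
  induction n with
  | zero =>
    intro P _ _ _ h hdim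
    obtain ⟨x, hx, hreg⟩ := exists_isSMulRegular (h 0 le_rfl)
    rw [← Module.supportDim_quotSMulTop_succ_eq_supportDim hreg hx] at hdim
    exact subsingleton_of_quotSMulTop hx
      ((Module.supportDim_eq_bot_iff_subsingleton R _).mp (WithBot.eq_bot_of_add_one_le_zero hdim))
  | succ n ih =>
    intro P _ _ _ h hdim
    obtain ⟨x, hx, hreg⟩ := exists_isSMulRegular (h 0 (by lia))
    rw [← Module.supportDim_quotSMulTop_succ_eq_supportDim hreg hx] at hdim
    exact subsingleton_of_quotSMulTop hx (ih (QuotSMulTop x P)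
      (fun i hi => (h i (by lia)).quotSMulTop hreg (h (i + 1) (by lia)))
      (WithBot.le_of_add_one_le_succ hdim))

lemma exists_socle_of_supportDim_le [IsNoetherianRing R] (n : ℕ) :
    ∀ (P : Type u) [AddCommGroup P] [Module R P] [Module.Finite R P] [Nontrivial P],
      Module.supportDim R P ≤ n →
      ∃ (s : ℕ) (L : Type u) (_ : AddCommGroup L) (_ : Module R L),
        Module.Finite R L ∧ ¬ ExtZero R (R ⧸ maximalIdeal R) L 0 ∧ s ≤ n ∧
        (∀ (X : Type u) [AddCommGroup X] [Module R X] (m : ℕ),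
          (∀ j, m < j → ExtZero R P X j) → ∀ j, m + s < j → ExtZero R L X j) ∧
        ∀ i < s, ExtZero R (R ⧸ maximalIdeal R) P i := by
  induction n with
  | zero =>
    intro P _ _ _ _ hdim
    refine ⟨0, P, inferInstance, inferInstance, inferInstance, fun h => ?_, le_rfl,
      fun X _ _ m h => h, by simp⟩
    exact not_subsingleton P (subsingleton_of_extZero_residue 0 P
      (fun i hi => by rwa [Nat.le_zero.mp hi]) hdim)
  | succ n ih =>
    intro P _ _ _ _ hdim
    by_cases h0 : ExtZero R (R ⧸ maximalIdeal R) P 0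
    · obtain ⟨x, hx, hreg⟩ := exists_isSMulRegular h0
      rw [← Module.supportDim_quotSMulTop_succ_eq_supportDim hreg hx] at hdim
      have := nontrivial_quotSMulTop_of_mem_maximalIdeal P hx
      obtain ⟨s, L, _, _, hfin, hsoc, hs, hvan, hdep⟩ :=
        ih (QuotSMulTop x P) (WithBot.le_of_add_one_le_succ hdim)
      refine ⟨s + 1, L, inferInstance, inferInstance, hfin, hsoc, by lia, ?_, ?_⟩
      · intro X _ _ m hm j hj
        refine hvan X (m + 1) (fun j hj => ?_) j (by lia)
        obtain ⟨j, rfl⟩ : ∃ k, j = k + 1 := ⟨j - 1, by lia⟩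
        exact (isSES_of_isSMulRegular hreg).con₃ j (hm j (by lia)) (hm (j + 1) (by lia))
      · intro i hi
        cases i with
        | zero => exact h0
        | succ i =>
          have hi' := hdep i (by lia)
          refine subsingleton_of_forall_eq 0 fun e => ?_
          have : extCov (R ⧸ maximalIdeal R) (LinearMap.lsmul R P x) (i + 1) e = 0 := by
            rw [extCov_smul_id, smul_ext_eq_zero_of_left (smul_residue_eq_zero hx)]
          obtain ⟨e', rfl⟩ := (isSES_of_isSMulRegular hreg).cov_exact₁ i e this
          rw [@Subsingleton.elim _ hi' e' 0, IsSES.covδ_zero]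
    · exact ⟨0, P, inferInstance, inferInstance, inferInstance, h0, by lia,
        fun X _ _ m h => h, by simp⟩

lemma extZero_of_finite_injDim [IsNoetherianRing R] {X L : Type u} [AddCommGroup X] [Module R X]
    [Module.Finite R X] [AddCommGroup L] [Module R L] [Module.Finite R L]
    (hL : ¬ ExtZero R (R ⧸ maximalIdeal R) L 0) {n s : ℕ}
    (hX : ∀ (W : Type u) [AddCommGroup W] [Module R W] [Module.Finite R W] (i : ℕ), n < i →
      ExtZero R W X i)
    (hs : ∀ j, s < j → ExtZero R L X j) :
    ∀ (W : Type u) [AddCommGroup W] [Module R W] [Module.Finite R W] (j : ℕ), s < j →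
      ExtZero R W X j := by
  suffices H : ∀ t j : ℕ, s < j → n < j + t →
      ∀ (W : Type u) [AddCommGroup W] [Module R W] [Module.Finite R W], ExtZero R W X j from
    fun W _ _ _ j hj => H (n + 1) j hj (by lia) W
  intro t
  induction t with
  | zero =>
    intro j _ hn W _ _ _
    exact hX W j hn
  | succ t ih =>
    intro j hj hn W _ _ _
    have hsucc := ih (j + 1) (by lia) (by lia)
    have hk : ExtZero R (R ⧸ maximalIdeal R) X j := by
      rw [extZero_zero_iff, not_subsingleton_iff_nontrivial] at hL
      obtain ⟨f, hf⟩ := exists_ne (0 : (R ⧸ maximalIdeal R) →ₗ[R] L)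
      have hinj : Function.Injective f := by
        have : IsSimpleModule R (R ⧸ maximalIdeal R) :=
          isSimpleModule_iff_isCoatom.mpr (maximalIdeal.isMaximal R).out
        exact LinearMap.injective_of_ne_zero hf
      have hses : IsSES f (LinearMap.range f).mkQ :=
        ⟨hinj, LinearMap.exact_map_mkQ_range f, Submodule.mkQ_surjective _⟩
      exact hses.con₁ j (hs j hj) (hsucc _)
    induction ‹Module.Finite R W› using
      IsNoetherianRing.induction_on_isQuotientEquivQuotientPrime R with
    | subsingleton W => exact extZero_of_subsingleton_left j
    | exact W₁ W₂ W₃ f g hf hg hfg h₁ h₃ => exact IsSES.con₂ ⟨hf, hfg, hg⟩ j h₁ h₃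
    | quotient W p e =>
      refine ExtZero.congr_left e ?_
      by_cases hp : p.1 = maximalIdeal R
      · rwa [hp]
      · obtain ⟨x, hx, hxp⟩ : ∃ x ∈ maximalIdeal R, x ∉ p.1 := by
          by_contra! hle
          exact hp (((maximalIdeal.isMaximal R).eq_of_le p.2.ne_top hle).symm)
        have hreg : IsSMulRegular (R ⧸ p.1) x := by
          have := p.2
          rw [isSMulRegular_iff_right_eq_zero_of_smul]
          intro a ha
          obtain ⟨a, rfl⟩ := Ideal.Quotient.mk_surjective a
          have : x * a ∈ p.1 := Ideal.Quotient.eq_zero_iff_mem.mp ha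
          exact Ideal.Quotient.eq_zero_iff_mem.mpr ((p.2.mem_or_mem this).resolve_left hxp)
        refine subsingleton_of_smul_surjective hx fun e => ?_
        obtain ⟨e', he'⟩ := (isSES_of_isSMulRegular hreg).con_surjective j (hsucc (QuotSMulTop x (R ⧸ p.1))) e
        exact ⟨e', by rw [← extCon_smul_id, he']⟩

end Nakayama

section HomSequences

variable {R : Type u} [CommRing R] {A B D W : Type u}
  [AddCommGroup A] [Module R A] [AddCommGroup B] [Module R B] [AddCommGroup D] [Module R D]
  [AddCommGroup W] [Module R W]

/-- Classes in `Ext^0` as linear maps. -/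
def homExt (f : A →ₗ[R] B) : Abelian.Ext (ModuleCat.of R A) (ModuleCat.of R B) 0 :=
  Abelian.Ext.mk₀ (ModuleCat.ofHom f)

lemma homExt_bijective : Function.Bijective (homExt : (A →ₗ[R] B) → _) :=
  (Abelian.Ext.mk₀_bijective _ _).comp (ModuleCat.homEquiv (M := ModuleCat.of R A)
    (N := ModuleCat.of R B)).symm.bijective

lemma extCov_homExt (f : A →ₗ[R] B) (u : W →ₗ[R] A) :
    extCov W f 0 (homExt u) = homExt (f ∘ₗ u) := by
  simp [extCov, homExt, ModuleCat.ofHom_comp]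

lemma extCon_homExt (f : A →ₗ[R] B) (u : B →ₗ[R] W) :
    extCon W f 0 (homExt u) = homExt (u ∘ₗ f) := by
  simp [extCon, homExt, ModuleCat.ofHom_comp]

namespace IsSES

variable {f : A →ₗ[R] B} {g : B →ₗ[R] D} (h : IsSES f g)

include h

lemma exists_lift (hA : ExtZero R W A 1) (u : W →ₗ[R] D) : ∃ v : W →ₗ[R] B, g ∘ₗ v = u := by
  obtain ⟨e, he⟩ := h.cov_surjective 0 hA (homExt u)
  obtain ⟨v, rfl⟩ := homExt_bijective.2 e
  rw [extCov_homExt] at he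
  exact ⟨v, homExt_bijective.1 he⟩

lemma exists_extend (hD : ExtZero R D W 1) (u : A →ₗ[R] W) : ∃ v : B →ₗ[R] W, v ∘ₗ f = u := by
  obtain ⟨e, he⟩ := h.con_surjective 0 hD (homExt u)
  obtain ⟨v, rfl⟩ := homExt_bijective.2 e
  rw [extCon_homExt] at he
  exact ⟨v, homExt_bijective.1 he⟩

lemma exists_of_comp_eq_zero (u : W →ₗ[R] B) (hu : g ∘ₗ u = 0) :
    ∃ v : W →ₗ[R] A, f ∘ₗ v = u := by
  have hr : ∀ x, u x ∈ LinearMap.range f := fun x => (h.exact (u x)).mp (LinearMap.congr_fun hu x)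
  refine ⟨(LinearEquiv.ofInjective f h.inj).symm ∘ₗ u.codRestrict _ hr, ?_⟩
  ext x
  exact congrArg Subtype.val ((LinearEquiv.ofInjective f h.inj).apply_symm_apply ⟨u x, hr x⟩)

lemma exists_factor (u : B →ₗ[R] W) (hu : u ∘ₗ f = 0) : ∃ v : D →ₗ[R] W, v ∘ₗ g = u := by
  have hk : LinearMap.ker g ≤ LinearMap.ker u := by
    intro x hx
    obtain ⟨y, rfl⟩ := (h.exact x).mp hx
    exact LinearMap.congr_fun hu y
  refine ⟨(LinearMap.ker g).liftQ u hk ∘ₗ (g.quotKerEquivOfSurjective h.surj).symm, ?_⟩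
  ext x
  have : (g.quotKerEquivOfSurjective h.surj).symm (g x) = (LinearMap.ker g).mkQ x := by
    rw [LinearEquiv.symm_apply_eq]
    rfl
  simp [this]

/-- The exact sequence `0 → Hom(W, A) → Hom(W, B) → Hom(W, D) → 0`. -/
lemma hom_cov (hA : ExtZero R W A 1) :
    IsSES (LinearMap.compRight R (M := W) f) (LinearMap.compRight R (M := W) g) where
  inj u v huv := LinearMap.ext fun x => h.inj (LinearMap.congr_fun huv x)
  exact u := by
    constructor
    · exact fun hu => h.exists_of_comp_eq_zero u hu
    · rintro ⟨v, rfl⟩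
      exact LinearMap.ext fun x => h.exact.apply_apply_eq_zero (v x)
  surj u := h.exists_lift hA u

/-- The exact sequence `0 → Hom(D, W) → Hom(B, W) → Hom(A, W) → 0`. -/
lemma hom_con (hD : ExtZero R D W 1) :
    IsSES (LinearMap.lcomp R W g) (LinearMap.lcomp R W f) where
  inj u v huv := LinearMap.ext fun x => by
    obtain ⟨y, rfl⟩ := h.surj x
    exact LinearMap.congr_fun huv y
  exact u := by
    constructor
    · exact fun hu => h.exists_factor u hu
    · rintro ⟨v, rfl⟩
      ext x
      exact (congrArg v (h.exact.apply_apply_eq_zero x)).trans (map_zero v)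
  surj u := h.exists_extend hD u

lemma covδ_bijective (n : ℕ) (hB : ExtZero R W B n)
    (hf : ∀ e : Abelian.Ext (ModuleCat.of R W) (ModuleCat.of R A) (n + 1),
      extCov W f (n + 1) e = 0) : Function.Bijective (h.covδ W n) := by
  refine ⟨fun e e' hee => ?_, fun e => h.cov_exact₁ n e (hf e)⟩
  rw [← sub_eq_zero, ← h.covδ_sub] at hee
  obtain ⟨b, hb⟩ := h.cov_exact₃ n _ hee
  rw [@Subsingleton.elim _ hB b 0, map_zero] at hb
  exact sub_eq_zero.mp hb.symm

end IsSES

lemma IsSES.succ_of_lsmul {r : R} {f : A →ₗ[R] A} {g : A →ₗ[R] D} (h : IsSES f g)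
    (hf : f = LinearMap.lsmul R A r) (hr : ∀ w : W, r • w = 0) {n : ℕ} (hD : ExtZero R W D n) :
    ExtZero R W A (n + 1) := by
  subst hf
  refine subsingleton_of_forall_eq 0 fun e => ?_
  obtain ⟨e', rfl⟩ := h.cov_exact₁ n e (by rw [extCov_smul_id, smul_ext_eq_zero_of_left hr])
  rw [@Subsingleton.elim _ hD e' 0, IsSES.covδ_zero]

end HomSequences

section MinimalCover

open IsLocalRing TensorProduct

variable {R : Type u} [CommRing R]

lemma mem_smul_top_pi_iff {n : ℕ} {I : Ideal R} {v : Fin n → R} :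
    v ∈ I • (⊤ : Submodule R (Fin n → R)) ↔ ∀ i, v i ∈ I := by
  constructor
  · intro hv i
    have := Submodule.mem_map_of_mem (f := LinearMap.proj (R := R) (φ := fun _ : Fin n => R) i) hv
    rw [Submodule.map_smul''] at this
    exact (Submodule.smul_mono le_rfl le_top this : v i ∈ I • (⊤ : Ideal R)) |> fun h => by
      simpa using h
  · intro hv
    have : v = ∑ i, v i • Pi.single (M := fun _ => R) i (1 : R) := by
      ext j
      simp [Pi.single_apply]
    rw [this]
    exact Submodule.sum_mem _ fun i _ => Submodule.smul_mem_smul (hv i) trivial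

lemma exists_minimal_cover [IsLocalRing R] (W : Type u) [AddCommGroup W] [Module R W] [Module.Finite R W] :
    ∃ (n : ℕ) (φ : (Fin n → R) →ₗ[R] W), Function.Surjective φ ∧
      LinearMap.ker φ ≤ maximalIdeal R • ⊤ := by
  let b := Module.finBasis (ResidueField R) (ResidueField R ⊗[R] W)
  have hs := TensorProduct.mk_surjective (R := R) W (ResidueField R) Ideal.Quotient.mk_surjective
  choose w hw using fun i => hs (b i)
  refine ⟨_, Fintype.linearCombination R w, ?_, ?_⟩
  · rw [← LinearMap.range_eq_top, Fintype.range_linearCombination]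
    exact IsLocalRing.span_eq_top_of_tmul_eq_basis w b hw
  · intro v hv
    rw [mem_smul_top_pi_iff]
    intro i
    have h0 : ∑ i, residue R (v i) • b i = 0 := by
      have := congrArg (TensorProduct.mk R (ResidueField R) W 1) (LinearMap.mem_ker.mp hv)
      rw [Fintype.linearCombination_apply, map_sum, map_zero] at this
      rw [← this]
      refine Finset.sum_congr rfl fun i _ => ?_
      rw [map_smul, hw]
      rfl
    have := Fintype.linearIndependent_iff.mp b.linearIndependent _ h0 i
    rwa [residue_eq_zero_iff] at this

end MinimalCover

section HomDepth

open IsLocalRing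
open scoped Pointwise

variable {R : Type u} [CommRing R] {W W' : Type u} [AddCommGroup W] [Module R W]
  [AddCommGroup W'] [Module R W']

lemma isSES_hom {P : Type u} [AddCommGroup P] [Module R P] {x : R}
    (hx : IsSMulRegular P x) (h : ExtZero R W P 1) :
    IsSES (LinearMap.lsmul R (W →ₗ[R] P) x)
      (LinearMap.compRight R (M := W) (x • (⊤ : Submodule R P)).mkQ) :=
  (isSES_of_isSMulRegular hx).hom_cov h

variable [IsLocalRing R] [IsNoetherianRing R] [Module.Finite R W] [Module.Finite R W']

variable (W) in
lemma extZero_residue_hom (t : ℕ) :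
    ∀ (P : Type u) [AddCommGroup P] [Module R P] [Module.Finite R P],
      (∀ i, 1 ≤ i → i ≤ t → ExtZero R W P i) →
      (∀ i < t, ExtZero R (R ⧸ maximalIdeal R) P i) →
      ∀ i < t, ExtZero R (R ⧸ maximalIdeal R) (W →ₗ[R] P) i := by
  induction t with
  | zero => simp
  | succ t ih =>
    intro P _ _ _ hW hk i hi
    obtain ⟨x, hx, hreg⟩ := exists_isSMulRegular (hk 0 (by lia))
    have hses := isSES_hom hreg (hW 1 le_rfl (by lia))
    cases i with
    | zero =>
      rw [extZero_zero_iff]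
      exact IsSMulRegular.subsingleton_linearMap_iff.mpr
        ⟨x, by rwa [Ideal.annihilator_quotient], hses.inj⟩
    | succ i =>
      refine hses.succ_of_lsmul rfl (smul_residue_eq_zero hx)
        (ih (QuotSMulTop x P) (fun j h1 hj => ?_) (fun j hj => ?_) i (by lia))
      · exact (hW j h1 (by lia)).quotSMulTop hreg (hW (j + 1) (by lia) (by lia))
      · exact (hk j (by lia)).quotSMulTop hreg (hk (j + 1) (by lia))

lemma extCov_residue_lcomp_bijective {φ : W' →ₗ[R] W} (hφ : Function.Surjective φ)
    (hker : LinearMap.ker φ ≤ maximalIdeal R • ⊤) (t : ℕ) :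
    ∀ (P : Type u) [AddCommGroup P] [Module R P] [Module.Finite R P],
      (∀ i, 1 ≤ i → i ≤ t → ExtZero R W P i) → (∀ i, 1 ≤ i → i ≤ t → ExtZero R W' P i) →
      (∀ i < t, ExtZero R (R ⧸ maximalIdeal R) P i) →
      Function.Bijective (extCov (R ⧸ maximalIdeal R) (LinearMap.lcomp R P φ) t) := by
  induction t with
  | zero =>
    intro P _ _ _ _ _ _
    have hinj : Function.Injective (LinearMap.lcomp R P φ) := fun u v huv => by
      ext y
      obtain ⟨y, rfl⟩ := hφ y
      exact LinearMap.congr_fun huv y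
    constructor
    · intro e e' he
      obtain ⟨u, rfl⟩ := homExt_bijective.2 e
      obtain ⟨u', rfl⟩ := homExt_bijective.2 e'
      rw [extCov_homExt, extCov_homExt] at he
      have := homExt_bijective.1 he
      congr 1
      exact LinearMap.ext fun a => hinj (LinearMap.congr_fun this a)
    · intro e
      obtain ⟨u, rfl⟩ := homExt_bijective.2 e
      have hses : IsSES (LinearMap.ker φ).subtype φ :=
        ⟨Submodule.subtype_injective _, LinearMap.exact_subtype_ker_map φ, hφ⟩
      have hu : ∀ a, ∃ v, LinearMap.lcomp R P φ v = u a := by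
        intro a
        refine hses.exists_factor (u a) ?_
        ext ⟨z, hz⟩
        change u a z = 0
        refine Submodule.smul_induction_on (p := fun z => u a z = 0) (hker hz) ?_ ?_
        · intro r hr z _
          rw [map_smul, ← LinearMap.smul_apply, ← map_smul, smul_residue_eq_zero hr, map_zero,
            LinearMap.zero_apply]
        · intro z z' h h'
          rw [map_add, h, h', add_zero]
      have hq : IsSES (LinearMap.lcomp R P φ) (LinearMap.range (LinearMap.lcomp R P φ)).mkQ :=
        ⟨hinj, LinearMap.exact_map_mkQ_range _, Submodule.mkQ_surjective _⟩
      obtain ⟨v, hv⟩ := hq.exists_of_comp_eq_zero u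
        (LinearMap.ext fun a => (hq.exact _).mpr (hu a))
      exact ⟨homExt v, by rw [extCov_homExt, hv]⟩
  | succ t ih =>
    intro P _ _ _ hW hW' hk
    obtain ⟨x, hx, hreg⟩ := exists_isSMulRegular (hk 0 (by lia))
    have hses := isSES_hom hreg (hW 1 le_rfl (by lia))
    have hses' := isSES_hom hreg (hW' 1 le_rfl (by lia))
    have hb := hses.covδ_bijective (W := R ⧸ maximalIdeal R) t
      (extZero_residue_hom W (t + 1) P hW hk t (by lia)) (fun e => by
        rw [extCov_smul_id, smul_ext_eq_zero_of_left (smul_residue_eq_zero hx)])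
    have hb' := hses'.covδ_bijective (W := R ⧸ maximalIdeal R) t
      (extZero_residue_hom W' (t + 1) P hW' hk t (by lia)) (fun e => by
        rw [extCov_smul_id, smul_ext_eq_zero_of_left (smul_residue_eq_zero hx)])
    have hi := ih (QuotSMulTop x P)
      (fun i h1 hi => (hW i h1 (by lia)).quotSMulTop hreg (hW (i + 1) (by lia) (by lia)))
      (fun i h1 hi => (hW' i h1 (by lia)).quotSMulTop hreg (hW' (i + 1) (by lia) (by lia)))
      (fun i hi => (hk i (by lia)).quotSMulTop hreg (hk (i + 1) (by lia)))
    have hcomm : extCov (R ⧸ maximalIdeal R) (LinearMap.lcomp R P φ) (t + 1) ∘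
        hses.covδ (R ⧸ maximalIdeal R) t = hses'.covδ (R ⧸ maximalIdeal R) t ∘
          extCov (R ⧸ maximalIdeal R) (LinearMap.lcomp R (QuotSMulTop x P) φ) t :=
      funext fun e => hses.covδ_naturality hses' (LinearMap.lcomp R P φ) (LinearMap.lcomp R P φ)
        (LinearMap.lcomp R (QuotSMulTop x P) φ) rfl rfl t e
    rw [← Function.Bijective.of_comp_iff _ hb, hcomm]
    exact hb'.comp hi

end HomDepth

section Tensor

open IsLocalRing TensorProduct

variable {R : Type u} [CommRing R] [IsLocalRing R]

lemma exists_surjective_residue (C : Type u) [AddCommGroup C] [Module R C] [Module.Finite R C]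
    [Nontrivial C] : ∃ ψ : C →ₗ[R] ResidueField R, Function.Surjective ψ := by
  have hnt : Nontrivial (ResidueField R ⊗[R] C) := by
    rw [← not_subsingleton_iff_nontrivial, IsLocalRing.subsingleton_tensorProduct]
    exact not_subsingleton C
  obtain ⟨v, hv⟩ := exists_ne (0 : ResidueField R ⊗[R] C)
  obtain ⟨f, hf⟩ : ∃ f : Module.Dual (ResidueField R) (ResidueField R ⊗[R] C), f v ≠ 0 := by
    by_contra! h
    exact hv ((Module.forall_dual_apply_eq_zero_iff _ v).mp h)
  obtain ⟨c, rfl⟩ := TensorProduct.mk_surjective (R := R) C (ResidueField R)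
    Ideal.Quotient.mk_surjective v
  refine ⟨(f.restrictScalars R) ∘ₗ TensorProduct.mk R (ResidueField R) C 1, fun y => ?_⟩
  obtain ⟨r, hr⟩ := residue_surjective (R := R) (y / f (1 ⊗ₜ c))
  refine ⟨r • c, ?_⟩
  rw [map_smul]
  change residue R r * f (1 ⊗ₜ c) = y
  rw [hr]
  exact div_mul_cancel₀ _ hf

lemma subsingleton_of_subsingleton_tensor {C D : Type u} [AddCommGroup C] [Module R C]
    [Module.Finite R C] [Nontrivial C] [AddCommGroup D] [Module R D] [Module.Finite R D]
    (h : Subsingleton (C ⊗[R] D)) : Subsingleton D := by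
  obtain ⟨ψ, hψ⟩ := exists_surjective_residue (R := R) C
  rw [← IsLocalRing.subsingleton_tensorProduct (R := R)]
  exact (LinearMap.rTensor_surjective D hψ).subsingleton

lemma surjective_of_lTensor_surjective (C : Type u) {D E : Type u} [AddCommGroup C] [Module R C]
    [Module.Finite R C] [Nontrivial C] [AddCommGroup D] [Module R D]
    [AddCommGroup E] [Module R E] [Module.Finite R E] {f : D →ₗ[R] E}
    (h : Function.Surjective (f.lTensor C)) : Function.Surjective f := by
  have : Subsingleton (C ⊗[R] (E ⧸ LinearMap.range f)) := by
    refine subsingleton_of_forall_eq 0 fun t => ?_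
    obtain ⟨t, rfl⟩ :=
      LinearMap.lTensor_surjective C (Submodule.mkQ_surjective (LinearMap.range f)) t
    obtain ⟨t, rfl⟩ := h t
    rw [← LinearMap.comp_apply, ← LinearMap.lTensor_comp, LinearMap.range_mkQ_comp,
      LinearMap.lTensor_zero, LinearMap.zero_apply]
  have := subsingleton_of_subsingleton_tensor this
  rw [← LinearMap.range_eq_top]
  exact Submodule.Quotient.subsingleton_iff.mp this

end Tensor

section FreeHom

variable {R : Type u} [CommRing R] {P W : Type u} [AddCommGroup P] [Module R P]
  [AddCommGroup W] [Module R W]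

/-- The inclusion `P → Hom(R^n, P)` of a coordinate factor. -/
def homFreeIncl (P : Type u) [AddCommGroup P] [Module R P] {n : ℕ} (j : Fin n) :
    P →ₗ[R] (Fin n → R) →ₗ[R] P :=
  LinearMap.smulRightₗ (LinearMap.proj j)

/-- The projection `Hom(R^n, P) → P` onto a coordinate factor. -/
def homFreeProj (P : Type u) [AddCommGroup P] [Module R P] {n : ℕ} (j : Fin n) :
    ((Fin n → R) →ₗ[R] P) →ₗ[R] P :=
  LinearMap.applyₗ (Pi.single j (1 : R))

@[simp]
lemma homFreeIncl_apply {n : ℕ} (j : Fin n) (p : P) (v : Fin n → R) :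
    homFreeIncl P j p v = v j • p := by
  simp [homFreeIncl]

@[simp]
lemma homFreeProj_apply {n : ℕ} (j : Fin n) (γ : (Fin n → R) →ₗ[R] P) :
    homFreeProj P j γ = γ (Pi.single j 1) := rfl

lemma homFreeProj_comp_homFreeIncl {n : ℕ} (j : Fin n) :
    homFreeProj P j ∘ₗ homFreeIncl (R := R) P j = LinearMap.id := by
  ext p
  simp

lemma sum_homFreeIncl {n : ℕ} (γ : (Fin n → R) →ₗ[R] P) :
    ∑ j, homFreeIncl P j (γ (Pi.single j 1)) = γ := by
  refine LinearMap.pi_ext' fun i => LinearMap.ext_ring ?_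
  simp [Pi.single_apply]

lemma ExtZero.homFree_left {i n : ℕ} (h : ExtZero R P W i) :
    ExtZero R ((Fin n → R) →ₗ[R] P) W i := by
  refine subsingleton_of_forall_eq 0 fun e => ?_
  have hid : (LinearMap.id : ((Fin n → R) →ₗ[R] P) →ₗ[R] _) =
      ∑ j, homFreeIncl P j ∘ₗ homFreeProj P j := by
    ext γ : 1
    simp [sum_homFreeIncl]
  rw [← extCon_id i e, hid, extCon_sum, LinearMap.sum_apply]
  refine Finset.sum_eq_zero fun j _ => ?_
  rw [extCon_comp, @Subsingleton.elim _ h (extCon W (homFreeIncl P j) i e) 0, map_zero]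

lemma mem_smul_top_hom {m n : ℕ} {I : Ideal R} {δ : (Fin m → R) →ₗ[R] (Fin n → R)}
    (h : ∀ v, δ v ∈ I • (⊤ : Submodule R (Fin n → R))) :
    δ ∈ I • (⊤ : Submodule R ((Fin m → R) →ₗ[R] (Fin n → R))) := by
  rw [← sum_homFreeIncl δ]
  refine Submodule.sum_mem _ fun j _ => ?_
  have := Submodule.mem_map_of_mem (f := homFreeIncl (R := R) (Fin n → R) j)
    (h (Pi.single j 1))
  rw [Submodule.map_smul''] at this
  exact Submodule.smul_mono le_rfl le_top this

lemma extCon_lcomp_mem_smul_top {A B Q X : Type u} [AddCommGroup A] [Module R A] [AddCommGroup B]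
    [Module R B] [AddCommGroup Q] [Module R Q] [AddCommGroup X] [Module R X] {I : Ideal R}
    {δ : A →ₗ[R] B} (h : δ ∈ I • (⊤ : Submodule R (A →ₗ[R] B))) {n : ℕ}
    (e : Abelian.Ext (ModuleCat.of R (A →ₗ[R] Q)) (ModuleCat.of R X) n) :
    extCon X (LinearMap.lcomp R Q δ) n e ∈
      I • (⊤ : Submodule R (Abelian.Ext (ModuleCat.of R (B →ₗ[R] Q)) (ModuleCat.of R X) n)) := by
  refine Submodule.smul_induction_on (p := fun δ => extCon X (LinearMap.lcomp R Q δ) n e ∈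
      I • (⊤ : Submodule R (Abelian.Ext (ModuleCat.of R (B →ₗ[R] Q)) (ModuleCat.of R X) n)))
    h ?_ ?_
  · intro r hr δ _
    have : LinearMap.lcomp R Q (r • δ) = r • LinearMap.lcomp R Q δ := by
      ext
      simp
    rw [this, extCon_smul]
    exact Submodule.smul_mem_smul hr trivial
  · intro δ δ' h h'
    have : LinearMap.lcomp R Q (δ + δ') = LinearMap.lcomp R Q δ + LinearMap.lcomp R Q δ' := by
      ext
      simp
    rw [this, extCon_add]
    exact Submodule.add_mem _ h h'

end FreeHom

section DepthHom

open IsLocalRing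

variable {R : Type u} [CommRing R] [IsLocalRing R]

lemma exists_minimal_cover_pos (C : Type u) [AddCommGroup C] [Module R C] [Module.Finite R C]
    [Nontrivial C] : ∃ (n : ℕ) (φ : (Fin n → R) →ₗ[R] C), Function.Surjective φ ∧
      LinearMap.ker φ ≤ maximalIdeal R • ⊤ ∧ Nonempty (Fin n) := by
  obtain ⟨n, φ, hφ, hker⟩ := exists_minimal_cover (R := R) C
  refine ⟨n, φ, hφ, hker, ?_⟩
  by_contra hn
  rw [not_nonempty_iff] at hn
  have := hφ.subsingleton
  exact not_subsingleton C this

lemma extZero_residue_of_hom [IsNoetherianRing R] {C P : Type u} [AddCommGroup C] [Module R C]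
    [Module.Finite R C] [Nontrivial C] [AddCommGroup P] [Module R P] [Module.Finite R P]
    {d : ℕ} (hC : ∀ i, 1 ≤ i → ExtZero R C P i)
    (hk : ∀ i < d, ExtZero R (R ⧸ maximalIdeal R) (C →ₗ[R] P) i) :
    ∀ i < d, ExtZero R (R ⧸ maximalIdeal R) P i := by
  obtain ⟨n, φ, hφ, hker, ⟨j⟩⟩ := exists_minimal_cover_pos (R := R) C
  intro i
  induction i using Nat.strong_induction_on with
  | _ i ih =>
    intro hi
    have hb := extCov_residue_lcomp_bijective hφ hker i P (fun j hj _ => hC j hj)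
      (fun j hj _ => by
        obtain ⟨j, rfl⟩ : ∃ l, j = l + 1 := ⟨j - 1, by lia⟩
        exact extZero_succ_of_projective j)
      (fun j hj => ih j hj (by lia))
    refine ExtZero.of_retract_right _ _ (homFreeProj_comp_homFreeIncl j) ?_
    exact @Function.Surjective.subsingleton _ _ _ (hk i hi) hb.2

end DepthHom

section SemidualizingDual

open IsLocalRing TensorProduct

variable {R : Type u} [CommRing R]

lemma isSES_ker {A B : Type u} [AddCommGroup A] [Module R A] [AddCommGroup B] [Module R B]
    {φ : A →ₗ[R] B} (hφ : Function.Surjective φ) : IsSES (LinearMap.ker φ).subtype φ :=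
  ⟨Subtype.val_injective, LinearMap.exact_subtype_ker_map φ, hφ⟩

lemma ExtZero.ker_left {m : ℕ} {K Q : Type u} [AddCommGroup K] [Module R K]
    [AddCommGroup Q] [Module R Q] {φ : (Fin m → R) →ₗ[R] K} (hφ : Function.Surjective φ)
    (hK : ∀ i, 1 ≤ i → ExtZero R K Q i) : ∀ i, 1 ≤ i → ExtZero R (LinearMap.ker φ) Q i := by
  rintro (_ | i) hi
  · lia
  · exact (isSES_ker hφ).con₁ _ (extZero_succ_of_projective i) (hK _ (by lia))

variable [IsLocalRing R] [IsNoetherianRing R]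
  {C X : Type u} [AddCommGroup C] [Module R C] [Module.Finite R C] [AddCommGroup X] [Module R X]
  {n : ℕ}

lemma extZero_hom_dual
    (hX : ∀ (W : Type u) [AddCommGroup W] [Module R W] [Module.Finite R W] (i : ℕ), n < i →
      ExtZero R W X i) {e : ℕ} (hCX : ∀ i, e < i → ExtZero R C X i)
    (K : Type u) [AddCommGroup K] [Module R K] [Module.Finite R K]
    (hK : ∀ i, 1 ≤ i → ExtZero R K C i) : ∀ i, e < i → ExtZero R (K →ₗ[R] C) X i := by
  suffices H : ∀ (t i : ℕ), e < i → n < i + t → ∀ (K : Type u) [AddCommGroup K] [Module R K]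
      [Module.Finite R K], (∀ i, 1 ≤ i → ExtZero R K C i) → ExtZero R (K →ₗ[R] C) X i from
    fun i hi => H (n + 1) i hi (by lia) K hK
  intro t
  induction t with
  | zero => exact fun i _ hi K _ _ _ _ => hX _ i hi
  | succ t ih =>
    intro i hi hn K _ _ _ hK
    obtain ⟨m, φ, hφ, -⟩ := exists_minimal_cover (R := R) K
    exact ((isSES_ker hφ).hom_con (hK 1 le_rfl)).con₁ i (hCX i hi).homFree_left
      (ih (i + 1) (by lia) (by lia) _ (ExtZero.ker_left hφ hK))

variable (hC : ∀ i, 1 ≤ i → ExtZero R C C i) (hb : Function.Bijective (LinearMap.lsmul R C))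

include hC hb

lemma extZero_of_semidualizing_of_succ [Nontrivial C] [Module.Finite R X]
    (hX : ∀ (W : Type u) [AddCommGroup W] [Module R W] [Module.Finite R W] (i : ℕ), n < i →
      ExtZero R W X i) {e : ℕ} (hCX : ∀ i, e + 1 < i → ExtZero R C X i) :
    ExtZero R C X (e + 1) := by
  obtain ⟨m, π, hπ, hker, ⟨j⟩⟩ := exists_minimal_cover_pos (R := R) C
  obtain ⟨m', π', hπ', -⟩ := exists_minimal_cover (R := R) (LinearMap.ker π)
  have hK := ExtZero.ker_left hπ hC
  have hK' := ExtZero.ker_left hπ' hK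
  have hs : Function.Surjective (extCon X (LinearMap.lcomp R C (LinearMap.ker π).subtype) (e + 1)) :=
    fun x => by
      refine ((isSES_ker hπ).hom_con (hC 1 le_rfl)).con_exact₂ (e + 1) x ?_
      have hR : ExtZero R (C →ₗ[R] C) X (e + 1) :=
        (extZero_succ_of_projective e).congr_left (LinearEquiv.ofBijective _ hb).symm
      exact @Subsingleton.elim _ hR _ _
  have hs' : Function.Surjective (extCon X (LinearMap.lcomp R C π') (e + 1)) :=
    ((isSES_ker hπ').hom_con (hK 1 le_rfl)).con_surjective (e + 1)
      (extZero_hom_dual hX hCX _ hK' _ (by lia))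
  refine ExtZero.of_retract_left _ _ (homFreeProj_comp_homFreeIncl (R := R) j)
    (subsingleton_of_forall_mem_smul_top (R := R) fun x => ?_)
  obtain ⟨y, rfl⟩ := hs x
  obtain ⟨z, rfl⟩ := hs' y
  rw [← extCon_comp]
  exact extCon_lcomp_mem_smul_top (δ := (LinearMap.ker π).subtype ∘ₗ π')
    (mem_smul_top_hom fun v => hker (π' v).2) z

lemma extZero_of_semidualizing [Nontrivial C] [Module.Finite R X]
    (hX : ∀ (W : Type u) [AddCommGroup W] [Module R W] [Module.Finite R W] (i : ℕ), n < i →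
      ExtZero R W X i) : ∀ i, 1 ≤ i → ExtZero R C X i := by
  suffices H : ∀ e, (∀ i, e < i → ExtZero R C X i) → ∀ i, 0 < i → ExtZero R C X i from
    H n fun i hi => hX C i hi
  intro e
  induction e with
  | zero => exact id
  | succ e ih =>
    refine fun h => ih fun i hi => ?_
    rcases eq_or_ne i (e + 1) with rfl | hne
    · exact extZero_of_semidualizing_of_succ hC hb hX h
    · exact h i (by lia)

omit [IsLocalRing R] [IsNoetherianRing R] [Module.Finite R C] hC hb in
lemma exists_eq_sum_tmul {m : ℕ} {H : Type u} [AddCommGroup H] [Module R H]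
    {π : (Fin m → R) →ₗ[R] C} (hπ : Function.Surjective π) (t : C ⊗[R] H) :
    ∃ q : Fin m → H, t = ∑ i, π (Pi.single i 1) ⊗ₜ q i := by
  induction t with
  | zero => exact ⟨0, by simp⟩
  | tmul c h =>
    obtain ⟨v, rfl⟩ := hπ c
    refine ⟨fun i => v i • h, ?_⟩
    simp_rw [← TensorProduct.smul_tmul, ← TensorProduct.sum_tmul, ← map_smul, ← map_sum]
    congr 2
    ext i
    simp [Pi.single_apply]
  | add a b ha hb =>
    obtain ⟨q, rfl⟩ := ha
    obtain ⟨q', rfl⟩ := hb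
    exact ⟨q + q', by simp [TensorProduct.tmul_add, Finset.sum_add_distrib]⟩

lemma evaluation_injective_of_semidualizing
    (hX : ∀ (W : Type u) [AddCommGroup W] [Module R W] [Module.Finite R W] (i : ℕ), n < i →
      ExtZero R W X i) (hCX : ∀ i, 0 < i → ExtZero R C X i) :
    Function.Injective (TensorProduct.lift (LinearMap.applyₗ : C →ₗ[R] (C →ₗ[R] X) →ₗ[R] X)) := by
  obtain ⟨m, π, hπ, -⟩ := exists_minimal_cover (R := R) C
  obtain ⟨m', π', hπ', -⟩ := exists_minimal_cover (R := R) (LinearMap.ker π)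
  have hK := ExtZero.ker_left hπ hC
  have hK' := ExtZero.ker_left hπ' hK
  rw [injective_iff_map_eq_zero]
  intro t ht
  obtain ⟨q, rfl⟩ := exists_eq_sum_tmul hπ t
  obtain ⟨u, hu⟩ := ((isSES_ker hπ).hom_con (hC 1 le_rfl)).exists_factor
    (∑ i, q i ∘ₗ homFreeProj C i) (by
      ext α
      obtain ⟨r, rfl⟩ := hb.2 α
      have := congrArg (r • ·) ht
      simpa [Finset.smul_sum] using this)
  obtain ⟨w, hw⟩ := ((isSES_ker hπ').hom_con (hK 1 le_rfl)).exists_extend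
    (extZero_hom_dual hX hCX _ hK' 1 one_pos) u
  have hq : ∀ i, q i = ∑ j, (π' (Pi.single j 1)).1 i • (w ∘ₗ homFreeIncl C j) := by
    intro i
    ext c
    have h1 : u (LinearMap.lcomp R C (LinearMap.ker π).subtype (homFreeIncl C i c)) = q i c := by
      have := LinearMap.congr_fun hu (homFreeIncl C i c)
      simpa [Pi.single_apply, apply_ite] using this
    rw [← h1, ← hw, LinearMap.comp_apply, ← sum_homFreeIncl (LinearMap.lcomp R C π' _), map_sum]
    simp
  simp_rw [hq, TensorProduct.tmul_sum, ← TensorProduct.smul_tmul]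
  rw [Finset.sum_comm]
  refine Finset.sum_eq_zero fun j _ => ?_
  rw [← TensorProduct.sum_tmul]
  have : ∑ i, (π' (Pi.single j 1)).1 i • π (Pi.single i 1) = π (π' (Pi.single j 1)).1 := by
    simp_rw [← map_smul, ← map_sum]
    congr 1
    ext i
    simp [Pi.single_apply]
  rw [this, LinearMap.mem_ker.mp (π' (Pi.single j 1)).2, TensorProduct.zero_tmul]

lemma coevaluation_surjective_of_semidualizing [Nontrivial C] {H : Type u} [AddCommGroup H]
    [Module R H] [Module.Finite R H]
    (hX : ∀ (W : Type u) [AddCommGroup W] [Module R W] [Module.Finite R W] (i : ℕ), n < i →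
      ExtZero R W (C ⊗[R] H) i) : Function.Surjective (TensorProduct.mk R C H).flip := by
  have hinj := evaluation_injective_of_semidualizing hC hb hX
    fun i hi => extZero_of_semidualizing hC hb hX i hi
  refine surjective_of_lTensor_surjective C fun t =>
    ⟨TensorProduct.lift LinearMap.applyₗ t, hinj ?_⟩
  induction t with
  | zero => simp
  | add a b ha hb => rw [map_add, map_add, map_add, ha, hb, ← map_add]
  | tmul c f =>
    simp only [TensorProduct.lift.tmul, LinearMap.applyₗ_apply_apply]
    induction f c with
    | zero => simp
    | add a b ha hb => rw [map_add, map_add, ha, hb]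
    | tmul c h => simp

end SemidualizingDual

section CoevaluationFree

open IsLocalRing TensorProduct

variable {R : Type u} [CommRing R] {C N W : Type u} [AddCommGroup C] [Module R C]
  [AddCommGroup N] [Module R N] [AddCommGroup W] [Module R W]

lemma sum_homFreeIncl_comp_homFreeProj (N : Type u) [AddCommGroup N] [Module R N] (n : ℕ) :
    ∑ j, homFreeIncl N j ∘ₗ homFreeProj N j = (LinearMap.id : ((Fin n → R) →ₗ[R] N) →ₗ[R] _) := by
  ext γ : 1
  simp [sum_homFreeIncl]

lemma sum_lTensor_homFree (C N : Type u) [AddCommGroup C] [Module R C] [AddCommGroup N]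
    [Module R N] (n : ℕ) :
    ∑ j, (homFreeIncl N j).lTensor C ∘ₗ (homFreeProj N j).lTensor C =
      (LinearMap.id : (C ⊗[R] ((Fin n → R) →ₗ[R] N)) →ₗ[R] _) := by
  simp_rw [← LinearMap.lTensor_comp]
  rw [← LinearMap.lTensor_id, ← sum_homFreeIncl_comp_homFreeProj]
  exact (map_sum (LinearMap.lTensorHom (R := R) C) _ _).symm

lemma ExtZero.tensor_homFree_right {i n : ℕ} (h : ExtZero R W (C ⊗[R] N) i) :
    ExtZero R W (C ⊗[R] ((Fin n → R) →ₗ[R] N)) i := by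
  refine subsingleton_of_forall_eq 0 fun e => ?_
  rw [← extCov_id i e, ← sum_lTensor_homFree, extCov_sum, LinearMap.sum_apply]
  refine Finset.sum_eq_zero fun j _ => ?_
  rw [extCov_comp, @Subsingleton.elim _ h (extCov W _ i e) 0, map_zero]

lemma coevaluation_naturality {N' : Type u} [AddCommGroup N'] [Module R N'] (f : N →ₗ[R] N') :
    LinearMap.compRight R (M := C) (f.lTensor C) ∘ₗ (TensorProduct.mk R C N).flip =
      (TensorProduct.mk R C N').flip ∘ₗ f := by
  ext
  simp

lemma coevaluation_homFree_bijective
    (h : Function.Bijective (TensorProduct.mk R C N).flip) (n : ℕ) :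
    Function.Bijective (TensorProduct.mk R C ((Fin n → R) →ₗ[R] N)).flip := by
  constructor
  · rw [injective_iff_map_eq_zero]
    intro γ hγ
    refine LinearMap.pi_ext' fun j => LinearMap.ext_ring ?_
    refine h.1 ?_
    have := LinearMap.congr_fun (coevaluation_naturality (C := C) (homFreeProj (R := R) N j)) γ
    rw [LinearMap.comp_apply, hγ, map_zero] at this
    simpa using this.symm
  · intro α
    choose ν hν using fun j => h.2 ((homFreeProj (R := R) N j).lTensor C ∘ₗ α)
    refine ⟨∑ j, homFreeIncl N j (ν j), ?_⟩
    have hα : α = ∑ j, ((homFreeIncl N j).lTensor C ∘ₗ (homFreeProj N j).lTensor C) ∘ₗ α := by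
      ext c
      exact (LinearMap.congr_fun (sum_lTensor_homFree C N n) (α c)).symm.trans (by simp)
    rw [hα, map_sum]
    refine Finset.sum_congr rfl fun j _ => ?_
    rw [LinearMap.comp_assoc, ← hν]
    exact (LinearMap.congr_fun (coevaluation_naturality (C := C) (homFreeIncl (R := R) N j)) (ν j)).symm

end CoevaluationFree

section Comparison

open IsLocalRing TensorProduct

variable {R : Type u} [CommRing R] [IsLocalRing R] [IsNoetherianRing R]
  {C X X' : Type u} [AddCommGroup C] [Module R C] [Module.Finite R C] [Nontrivial C]
  [AddCommGroup X] [Module R X] [Module.Finite R X]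
  [AddCommGroup X'] [Module R X'] [Module.Finite R X'] {d : ℕ}

lemma extCov_residue_bijective_of_compRight (hCX : ∀ i, 1 ≤ i → ExtZero R C X i)
    (hCX' : ∀ i, 1 ≤ i → ExtZero R C X' i)
    (hk : ∀ i < d, ExtZero R (R ⧸ maximalIdeal R) X i)
    (hk' : ∀ i < d, ExtZero R (R ⧸ maximalIdeal R) X' i) {f : X →ₗ[R] X'}
    (hf : Function.Bijective
      (extCov (R ⧸ maximalIdeal R) (LinearMap.compRight R (M := C) f) d)) :
    Function.Bijective (extCov (R ⧸ maximalIdeal R) f d) := by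
  obtain ⟨n, π, hπ, hker, ⟨j⟩⟩ := exists_minimal_cover_pos (R := R) C
  have hfree : ∀ (Z : Type u) [AddCommGroup Z] [Module R Z] (i : ℕ), 1 ≤ i → i ≤ d →
      ExtZero R (Fin n → R) Z i := fun Z _ _ i hi _ => by
    obtain ⟨l, rfl⟩ : ∃ l, i = l + 1 := ⟨i - 1, by lia⟩
    exact extZero_succ_of_projective l
  have hE := extCov_residue_lcomp_bijective hπ hker d X (fun i hi _ => hCX i hi) (hfree X) hk
  have hE' := extCov_residue_lcomp_bijective hπ hker d X' (fun i hi _ => hCX' i hi) (hfree X') hk'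
  set k := R ⧸ maximalIdeal R
  have hg : Function.Bijective (extCov k (LinearMap.compRight R (M := Fin n → R) f) d) := by
    rw [← Function.Bijective.of_comp_iff _ hE]
    convert hE'.comp hf using 1
    ext x
    rw [Function.comp_apply, Function.comp_apply, ← extCov_comp, ← extCov_comp]
    rfl
  have hi : LinearMap.compRight R (M := Fin n → R) f ∘ₗ homFreeIncl X j =
      homFreeIncl X' j ∘ₗ f := by
    ext
    simp
  have hp : homFreeProj X' j ∘ₗ LinearMap.compRight R (M := Fin n → R) f =
      f ∘ₗ homFreeProj X j := rfl
  constructor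
  · rw [injective_iff_map_eq_zero]
    intro x hx
    have : extCov k (homFreeIncl X j) d x = 0 := by
      refine hg.1 ?_
      rw [← extCov_comp, hi, extCov_comp, hx, map_zero, map_zero]
    rw [← extCov_id d x, ← homFreeProj_comp_homFreeIncl j, extCov_comp, this, map_zero]
  · intro y
    obtain ⟨z, hz⟩ := hg.2 (extCov k (homFreeIncl X' j) d y)
    refine ⟨extCov k (homFreeProj X j) d z, ?_⟩
    rw [← extCov_comp, ← hp, extCov_comp, hz, ← extCov_comp, homFreeProj_comp_homFreeIncl,
      extCov_id]

omit [IsLocalRing R] [Module.Finite R X'] [Nontrivial C] in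
lemma injective_of_compRight_injective (hfaith : Module.annihilator R C = ⊥)
    {f : X →ₗ[R] X'} (hf : Function.Injective (LinearMap.compRight R (M := C) f)) :
    Function.Injective f := by
  have : Subsingleton (C →ₗ[R] LinearMap.ker f) := by
    refine subsingleton_of_forall_eq 0 fun α => ?_
    have : (LinearMap.ker f).subtype ∘ₗ α = 0 := hf (by
      ext c
      simp)
    ext c
    exact LinearMap.congr_fun this c
  rw [← LinearMap.ker_eq_bot, ← Submodule.subsingleton_iff_eq_bot]
  obtain ⟨r, hr, hreg⟩ := IsSMulRegular.subsingleton_linearMap_iff.mp this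
  rw [hfaith, Submodule.mem_bot] at hr
  rw [hr] at hreg
  exact IsSMulRegular.zero_iff_subsingleton.mp hreg

omit [IsLocalRing R] [IsNoetherianRing R] [Module.Finite R X] [Module.Finite R X'] in
lemma IsSES.extCov_covδ {D W : Type u} [AddCommGroup D] [Module R D] [AddCommGroup W]
    [Module R W] {f : X →ₗ[R] X'} {g : X' →ₗ[R] D} (h : IsSES f g) (n : ℕ)
    (e : Abelian.Ext (ModuleCat.of R W) (ModuleCat.of R D) n) :
    extCov W f (n + 1) (h.covδ W n e) = 0 := by
  have := h.shortExact.extClass_comp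
  simp only at this
  simp [extCov, covδ, this]

omit [Module.Finite R X] in
lemma surjective_of_extCov_residue_bijective (hdim : ringKrullDim R ≤ d) {f : X →ₗ[R] X'}
    (hinj : Function.Injective f)
    (hk' : ∀ i < d, ExtZero R (R ⧸ maximalIdeal R) X' i)
    (hk : ∀ i < d, ExtZero R (R ⧸ maximalIdeal R) X i)
    (hkd : ExtZero R (R ⧸ maximalIdeal R) X (d + 1))
    (hf : Function.Bijective (extCov (R ⧸ maximalIdeal R) f d)) : Function.Surjective f := by
  have hs : IsSES f (LinearMap.range f).mkQ :=
    ⟨hinj, LinearMap.exact_map_mkQ_range f, Submodule.mkQ_surjective _⟩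
  have : Subsingleton (X' ⧸ LinearMap.range f) := by
    refine subsingleton_of_extZero_residue d _ (fun i hi => ?_)
      ((Module.supportDim_le_ringKrullDim R _).trans hdim)
    rcases hi.eq_or_lt with rfl | hi
    · refine subsingleton_of_forall_eq 0 fun e => ?_
      obtain ⟨b, rfl⟩ := hs.cov_exact₃ _ e (@Subsingleton.elim _ hkd _ _)
      obtain ⟨a, rfl⟩ := hf.2 b
      rw [← extCov_comp, hs.exact.linearMap_comp_eq_zero, extCov_zero, LinearMap.zero_apply]
    · refine subsingleton_of_forall_eq 0 fun e => ?_
      obtain ⟨b, rfl⟩ := hs.cov_exact₃ _ e (by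
        rcases (Nat.succ_le_of_lt hi).eq_or_lt with rfl | hi'
        · exact hf.1 ((hs.extCov_covδ i e).trans (map_zero _).symm)
        · exact @Subsingleton.elim _ (hk _ hi') _ _)
      rw [@Subsingleton.elim _ (hk' i hi) b 0, map_zero]
  rw [← LinearMap.range_eq_top]
  exact Submodule.Quotient.subsingleton_iff.mp this

end Comparison

section FiniteLength

open IsLocalRing

variable {R : Type u} [CommRing R] [IsLocalRing R] [IsNoetherianRing R]
  {W Y : Type u} [AddCommGroup W] [Module R W] [Module.Finite R W]
  [AddCommGroup Y] [Module R Y] [Module.Finite R Y] {d : ℕ}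

lemma extZero_of_pow_le_annihilator [Nontrivial Y]
    (hk : ∀ i < d, ExtZero R (R ⧸ maximalIdeal R) Y i) {n : ℕ}
    (hW : maximalIdeal R ^ n ≤ Module.annihilator R W) : ∀ i < d, ExtZero R W Y i := by
  intro i hi
  rcases subsingleton_or_nontrivial W with hs | hnt
  · exact extZero_of_subsingleton_left i
  have hlt : maximalIdeal R • (⊤ : Submodule R (ModuleCat.of R Y)) < ⊤ := by
    refine lt_top_iff_ne_top.mpr fun h => not_subsingleton Y ?_
    exact subsingleton_of_forall_mem_smul_top (R := R) (E := Y) fun e => h.ge (Submodule.mem_top)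
  have htfae := (ModuleCat.exists_isRegular_tfae (maximalIdeal R) d (ModuleCat.of R Y) hlt).out 2 0
  refine htfae.mp
    ⟨ModuleCat.of R (R ⧸ maximalIdeal R), inferInstanceAs (Nontrivial (R ⧸ maximalIdeal R)),
      inferInstanceAs (Module.Finite R (R ⧸ maximalIdeal R)), ?_, hk⟩
    (ModuleCat.of R W) hnt ‹_› ?_ i hi
  · change Module.support R (R ⧸ maximalIdeal R) = _
    rw [Module.support_eq_zeroLocus, Ideal.annihilator_quotient]
  · intro p hp
    exact p.2.le_of_pow_le (hW.trans (Module.annihilator_le_of_mem_support hp))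

lemma extCon_injective_of_pow_le_annihilator [Nontrivial Y]
    (hk : ∀ i < d, ExtZero R (R ⧸ maximalIdeal R) Y i) {n : ℕ}
    (hW : maximalIdeal R ^ n ≤ Module.annihilator R W) {Z : Type u} [AddCommGroup Z] [Module R Z]
    {g : W →ₗ[R] Z} (hg : Function.Surjective g) : Function.Injective (extCon Y g d) := by
  cases d with
  | zero =>
    intro x y hxy
    obtain ⟨x, rfl⟩ := homExt_bijective.2 x
    obtain ⟨y, rfl⟩ := homExt_bijective.2 y
    rw [extCon_homExt, extCon_homExt] at hxy
    exact congrArg homExt ((LinearMap.cancel_right hg).mp (homExt_bijective.1 hxy))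
  | succ d =>
    refine (isSES_ker hg).con_injective d (extZero_of_pow_le_annihilator (n := n) hk ?_ d d.lt_succ_self)
    exact hW.trans (LinearMap.annihilator_le_of_injective (LinearMap.ker g).subtype Subtype.val_injective)

lemma annihilator_eq_bot_of_injDim [Nontrivial Y] (hdim : ringKrullDim R ≤ d)
    (hk : ∀ i < d, ExtZero R (R ⧸ maximalIdeal R) Y i)
    (hY : ∀ (W : Type u) [AddCommGroup W] [Module R W] [Module.Finite R W],
      ExtZero R W Y (d + 1)) : Module.annihilator R Y = ⊥ := by
  rw [eq_bot_iff, ← Ideal.iInf_pow_eq_bot_of_isLocalRing _ (Ideal.IsPrime.ne_top (maximalIdeal.isMaximal R).isPrime)]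
  refine le_iInf fun n r hr => ?_
  by_contra hrn
  let L := R ⧸ maximalIdeal R ^ n
  let ρ : L →ₗ[R] L := LinearMap.lsmul R L r
  have hL : maximalIdeal R ^ n ≤ Module.annihilator R L := (Ideal.annihilator_quotient).ge
  have : Nontrivial (LinearMap.range ρ) := by
    refine ⟨⟨ρ 1, LinearMap.mem_range_self _ _⟩, 0, fun h => hrn ?_⟩
    rw [← Ideal.Quotient.eq_zero_iff_mem]
    have := congrArg Subtype.val h
    have h' : algebraMap R L r = 0 := by
      simpa only [ρ, LinearMap.lsmul_apply, Algebra.smul_def, mul_one, ZeroMemClass.coe_zero]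
        using this
    exact h'
  have h0 : ExtZero R (LinearMap.range ρ) Y d := by
    have hs : IsSES (LinearMap.range ρ).subtype (LinearMap.range ρ).mkQ :=
      ⟨Subtype.val_injective, LinearMap.exact_subtype_mkQ _, Submodule.mkQ_surjective _⟩
    refine subsingleton_of_forall_eq 0 fun x => ?_
    obtain ⟨y, rfl⟩ := hs.con_surjective d (hY _) x
    refine extCon_injective_of_pow_le_annihilator hk hL ρ.surjective_rangeRestrict ?_
    rw [← extCon_comp, map_zero]
    have : (LinearMap.range ρ).subtype ∘ₗ ρ.rangeRestrict = LinearMap.lsmul R L r := rfl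
    rw [this, extCon_smul_id]
    exact smul_ext_eq_zero_of_right (fun y => Module.mem_annihilator.mp hr y) y
  obtain ⟨ψ, hψ⟩ := exists_surjective_residue (R := R) (LinearMap.range ρ)
  have hkd : ExtZero R (R ⧸ maximalIdeal R) Y d := by
    have := extCon_injective_of_pow_le_annihilator hk (n := n)
      (hL.trans (LinearMap.annihilator_le_of_injective (LinearMap.range ρ).subtype
        Subtype.val_injective)) hψ
    exact @Function.Injective.subsingleton _ _ _ this h0
  refine not_subsingleton Y (subsingleton_of_extZero_residue d Y (fun i hi => ?_)
    ((Module.supportDim_le_ringKrullDim R Y).trans hdim))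
  rcases hi.eq_or_lt with rfl | hi
  · exact hkd
  · exact hk i hi

end FiniteLength

section Main

open IsLocalRing TensorProduct

variable {R : Type u} [CommRing R] [IsLocalRing R] [IsNoetherianRing R]

lemma exists_injDim_bound {d : ℕ} (hdim : ringKrullDim R ≤ d) :
    ∃ s ≤ d, (∀ i < s, ExtZero R (R ⧸ maximalIdeal R) R i) ∧
      ∀ (X : Type u) [AddCommGroup X] [Module R X] [Module.Finite R X],
        (∃ n, ∀ (W : Type u) [AddCommGroup W] [Module R W] [Module.Finite R W] (i : ℕ), n < i →
          ExtZero R W X i) →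
        ∀ (W : Type u) [AddCommGroup W] [Module R W] [Module.Finite R W] (j : ℕ), s < j →
          ExtZero R W X j := by
  obtain ⟨s, L, _, _, _, hL, hs, hj, hk⟩ := exists_socle_of_supportDim_le d R
    ((Module.supportDim_le_ringKrullDim R R).trans hdim)
  refine ⟨s, hs, hk, fun X _ _ _ ⟨n, hX⟩ => extZero_of_finite_injDim hL hX fun j hsj => ?_⟩
  refine hj X 0 (fun i hi => ?_) j (by lia)
  obtain ⟨i, rfl⟩ : ∃ l, i = l + 1 := ⟨i - 1, by lia⟩
  exact extZero_succ_of_projective i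

variable {C M N : Type u} [AddCommGroup C] [Module R C] [Module.Finite R C]
  [AddCommGroup M] [Module R M] [Module.Finite R M]
  [AddCommGroup N] [Module R N] [Module.Finite R N]

lemma extZero_residue_tensor [Nontrivial C] {d : ℕ}
    (hη : Function.Bijective (TensorProduct.mk R C N).flip)
    (hCY : ∀ i, 1 ≤ i → ExtZero R C (C ⊗[R] N) i)
    (hk : ∀ i < d, ExtZero R (R ⧸ maximalIdeal R) N i) :
    ∀ i < d, ExtZero R (R ⧸ maximalIdeal R) (C ⊗[R] N) i :=
  extZero_residue_of_hom hCY fun i hi => (hk i hi).congr_right (LinearEquiv.ofBijective _ hη).symm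

omit [IsLocalRing R] [IsNoetherianRing R] [Module.Finite R C] [Module.Finite R N] in
lemma coevaluation_injective_of_injective {H : Type u} [AddCommGroup H] [Module R H]
    (hη : Function.Injective (TensorProduct.mk R C N).flip) {f : H →ₗ[R] N}
    (hf : Function.Injective f) : Function.Injective (TensorProduct.mk R C H).flip := by
  have := hη.comp hf
  rw [← LinearMap.coe_comp, ← coevaluation_naturality, LinearMap.coe_comp] at this
  exact this.of_comp

omit [IsLocalRing R] [IsNoetherianRing R] [Module.Finite R M] [Module.Finite R N] in
lemma extCov_bijective_of_bijective {W : Type u} [AddCommGroup W] [Module R W] {f : M →ₗ[R] N}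
    (hf : Function.Bijective f) (n : ℕ) : Function.Bijective (extCov W f n) := by
  let e := LinearEquiv.ofBijective f hf
  refine Function.bijective_iff_has_inverse.mpr ⟨extCov W e.symm n, fun x => ?_, fun x => ?_⟩
  · rw [← extCov_comp, show (e.symm : N →ₗ[R] M) ∘ₗ f = LinearMap.id from e.symm_comp, extCov_id]
  · rw [← extCov_comp, show f ∘ₗ (e.symm : N →ₗ[R] M) = LinearMap.id from e.comp_symm, extCov_id]

theorem lcomp_surjective_of_finite_injDim {d : ℕ} (hdim : ringKrullDim R ≤ d)
    (hC : ∀ i, 1 ≤ i → ExtZero R C C i) (hb : Function.Bijective (LinearMap.lsmul R C))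
    (hη : Function.Bijective (TensorProduct.mk R C N).flip)
    (hCY : ∀ i, 1 ≤ i → ExtZero R C (C ⊗[R] N) i)
    (hk : ∀ i < d, ExtZero R (R ⧸ maximalIdeal R) N i)
    (hMN : ∀ i, 1 ≤ i → i ≤ d → ExtZero R M N i)
    (hX : ∃ n, ∀ (W : Type u) [AddCommGroup W] [Module R W] [Module.Finite R W] (i : ℕ), n < i →
      ExtZero R W (C ⊗[R] (M →ₗ[R] N)) i) {a : ℕ} {φ : (Fin a → R) →ₗ[R] M}
    (hφ : Function.Surjective φ) (hker : LinearMap.ker φ ≤ maximalIdeal R • ⊤) :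
    Function.Surjective (LinearMap.lcomp R N φ) := by
  have hannC : Module.annihilator R C = ⊥ := by
    rw [eq_bot_iff]
    intro r hr
    exact hb.1 (by ext c; simpa using Module.mem_annihilator.mp hr c)
  have : Nontrivial C := by
    rw [← not_subsingleton_iff_nontrivial]
    intro h
    rw [Module.annihilator_eq_top_iff.mpr h] at hannC
    exact top_ne_bot hannC
  obtain ⟨s, hsd, -, hbd⟩ := exists_injDim_bound hdim
  have hXd := hbd _ hX
  obtain ⟨n, hX⟩ := hX
  have hηF := coevaluation_homFree_bijective hη a
  set ι := LinearMap.lcomp R N φ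
  have hι : Function.Injective ι := fun u v huv => (LinearMap.cancel_right hφ).mp huv
  have hηH : Function.Bijective (TensorProduct.mk R C (M →ₗ[R] N)).flip :=
    ⟨coevaluation_injective_of_injective hηF.1 hι, coevaluation_surjective_of_semidualizing hC hb hX⟩
  have hCX : ∀ i, 1 ≤ i → ExtZero R C (C ⊗[R] (M →ₗ[R] N)) i :=
    extZero_of_semidualizing hC hb hX
  have hkX := extZero_residue_tensor hηH hCX (extZero_residue_hom M d N hMN hk)
  have hkF : ∀ i < d, ExtZero R (R ⧸ maximalIdeal R) (C ⊗[R] ((Fin a → R) →ₗ[R] N)) i :=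
    fun i hi => (extZero_residue_tensor hη hCY hk i hi).tensor_homFree_right
  have hnat := coevaluation_naturality (C := C) ι
  have hbi := extCov_residue_lcomp_bijective hφ hker d N hMN (fun i hi _ => by
    obtain ⟨l, rfl⟩ : ∃ l, i = l + 1 := ⟨i - 1, by lia⟩
    exact extZero_succ_of_projective l) hk
  have hcomp : Function.Bijective (extCov (R ⧸ maximalIdeal R)
      (LinearMap.compRight R (M := C) (ι.lTensor C)) d) := by
    rw [← Function.Bijective.of_comp_iff _ (extCov_bijective_of_bijective hηH d)]
    convert (extCov_bijective_of_bijective hηF d).comp hbi using 1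
    ext x
    rw [Function.comp_apply, Function.comp_apply, ← extCov_comp, ← extCov_comp, hnat]
  have hfb := extCov_residue_bijective_of_compRight hCX
    (fun i hi => (hCY i hi).tensor_homFree_right) hkX hkF hcomp
  have hfi : Function.Injective (ι.lTensor C) := by
    refine injective_of_compRight_injective hannC fun u v huv => ?_
    obtain ⟨u, rfl⟩ := hηH.2 u
    obtain ⟨v, rfl⟩ := hηH.2 v
    have := hηF.1 (((LinearMap.congr_fun hnat u).symm.trans huv).trans (LinearMap.congr_fun hnat v))
    rw [hι this]
  exact surjective_of_lTensor_surjective C (surjective_of_extCov_residue_bijective hdim hfi hkF hkX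
    (hXd _ _ (by lia)) hfb)

end Main

section Conclusion

open IsLocalRing TensorProduct

variable {R : Type u} [CommRing R]

lemma ExtZero.tensor_right_of_lcomp_surjective {C M N W : Type u} [AddCommGroup C] [Module R C]
    [AddCommGroup M] [Module R M] [AddCommGroup N] [Module R N] [AddCommGroup W] [Module R W]
    {a : ℕ} {φ : (Fin a → R) →ₗ[R] M} (hφ : Function.Surjective φ)
    (hι : Function.Surjective (LinearMap.lcomp R N φ)) (j : Fin a) {i : ℕ}
    (h : ExtZero R W (C ⊗[R] (M →ₗ[R] N)) i) : ExtZero R W (C ⊗[R] N) i := by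
  let e := LinearEquiv.ofBijective (LinearMap.lcomp R N φ)
    ⟨fun u v huv => (LinearMap.cancel_right hφ).mp huv, hι⟩
  refine h.of_retract_right (((e.symm : _ →ₗ[R] _) ∘ₗ homFreeIncl N j).lTensor C)
    ((homFreeProj N j ∘ₗ (e : _ →ₗ[R] _)).lTensor C) ?_
  rw [← LinearMap.lTensor_comp, ← LinearMap.lTensor_id]
  congr 1
  ext x
  simp

lemma injective_of_lcomp_surjective {M N : Type u} [AddCommGroup M] [Module R M] [AddCommGroup N]
    [Module R N] (hN : Module.annihilator R N = ⊥) {a : ℕ} {φ : (Fin a → R) →ₗ[R] M}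
    (hι : Function.Surjective (LinearMap.lcomp R N φ)) : Function.Injective φ := by
  rw [injective_iff_map_eq_zero]
  intro v hv
  ext i
  refine (Submodule.mem_bot R).mp (hN.le (Module.mem_annihilator.mpr fun x => ?_))
  obtain ⟨u, hu⟩ := hι (homFreeIncl N i x)
  rw [← homFreeIncl_apply i x v, ← hu]
  change u (φ v) = 0
  rw [hv, map_zero]

end Conclusion

theorem cm_free_of_finite_C_injdim_hom_mcm
    (R : Type) [CommRing R] [IsNoetherianRing R] [IsLocalRing R]
    (d : ℕ) (hd : ringKrullDim R = d)
    (C : Type) [AddCommGroup C] [Module R C] [Module.Finite R C]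
    (hC : IsSemidualizing R C)
    (M N : Type) [AddCommGroup M] [Module R M] [AddCommGroup N] [Module R N]
    [Module.Finite R M] [Module.Finite R N] [Nontrivial M] [Nontrivial N]
    (hN : MemAuslanderClass R C N) (hNmcm : moduleDepth R N = d)
    (hCinj : HasFiniteInjDim R (TensorProduct R C (M →ₗ[R] N)))
    (hext : ∀ i : ℕ, 1 ≤ i → i ≤ d → Subsingleton (extMod R i M N)) :
    moduleDepth R R = d ∧ Module.Free R M ∧ HasFiniteInjDim R (TensorProduct R C N) := by
  have hdim : ringKrullDim R ≤ d := hd.le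
  have hC' : ∀ i, 1 ≤ i → ExtZero R C C i := fun i hi =>
    (subsingleton_extMod_iff C C i).mp (hC.ext_vanish i hi)
  have hCY : ∀ i, 1 ≤ i → ExtZero R C (TensorProduct R C N) i := fun i hi =>
    (subsingleton_extMod_iff _ _ i).mp (hN.ext_vanish i hi)
  have hkN : ∀ i < d, ExtZero R (R ⧸ IsLocalRing.maximalIdeal R) N i := fun i hi => by
    rw [← subsingleton_extMod_iff]
    exact not_not.mp (Nat.notMem_of_lt_sInf (hi.trans_eq hNmcm.symm))
  obtain ⟨n, hn⟩ := hCinj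
  obtain ⟨a, φ, hφ, hker, ⟨j⟩⟩ := exists_minimal_cover_pos (R := R) M
  have hι : Function.Surjective (LinearMap.lcomp R N φ) :=
    lcomp_surjective_of_finite_injDim hdim hC' hC.bijective hN.bijective hCY hkN
      (fun i hi hid => (subsingleton_extMod_iff M N i).mp (hext i hi hid))
      ⟨n, fun W _ _ _ i hi => (subsingleton_extMod_iff _ _ i).mp (hn W i hi)⟩ hφ hker
  have hY : ∀ (W : Type) [AddCommGroup W] [Module R W] (i : ℕ), n < i →
      ExtZero R W (TensorProduct R C N) i := fun W _ _ i hi =>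
    ((subsingleton_extMod_iff _ _ i).mp (hn W i hi)).tensor_right_of_lcomp_surjective hφ hι j
  have hnt : Nontrivial C := by
    rw [← not_subsingleton_iff_nontrivial]
    intro h
    exact not_subsingleton R (hC.bijective.1.subsingleton)
  have hntY : Nontrivial (TensorProduct R C N) := by
    rw [← not_subsingleton_iff_nontrivial]
    exact fun h => not_subsingleton N (subsingleton_of_subsingleton_tensor h)
  have hkY := extZero_residue_tensor hN.bijective hCY hkN
  obtain ⟨s, hsd, hkR, hbd⟩ := exists_injDim_bound hdim
  have hYs := hbd (TensorProduct R C N) ⟨n, fun W _ _ _ i hi => hY W i hi⟩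
  obtain rfl : s = d := by
    by_contra hne
    refine not_subsingleton (TensorProduct R C N) (subsingleton_of_extZero_residue d _
      (fun i hi => ?_) ((Module.supportDim_le_ringKrullDim R _).trans hdim))
    rcases hi.eq_or_lt with rfl | hi
    · exact hYs _ _ (by lia)
    · exact hkY i hi
  have hann := annihilator_eq_bot_of_injDim hdim hkY fun W _ _ _ => hYs W (s + 1) (by lia)
  have hannN : Module.annihilator R N = ⊥ := by
    rw [eq_bot_iff, ← hann]
    intro r hr
    refine Module.mem_annihilator.mpr fun t => ?_
    induction t with
    | zero => simp
    | add x y hx hy => rw [smul_add, hx, hy, add_zero]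
    | tmul c x => rw [← TensorProduct.tmul_smul, Module.mem_annihilator.mp hr, TensorProduct.tmul_zero]
  have hmem : s ∈ {i : ℕ | ¬ Subsingleton (extMod R i (R ⧸ IsLocalRing.maximalIdeal R) R)} := by
    intro h
    refine not_subsingleton R (subsingleton_of_extZero_residue s R (fun i hi => ?_)
      ((Module.supportDim_le_ringKrullDim R R).trans hdim))
    rcases hi.eq_or_lt with rfl | hi
    · exact (subsingleton_extMod_iff _ _ i).mp h
    · exact hkR i hi
  refine ⟨le_antisymm (Nat.sInf_le hmem) (le_csInf ⟨s, hmem⟩ fun i hi => ?_), ?_, n,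
    fun W _ _ i hi => (subsingleton_extMod_iff _ _ i).mpr (hY W i hi)⟩
  · by_contra! his
    exact hi ((subsingleton_extMod_iff _ _ i).mpr (hkR i his))
  · exact Module.Free.of_equiv
      (LinearEquiv.ofBijective φ ⟨injective_of_lcomp_surjective hannN hι, hφ⟩)
end
end

section
/- Let R be a commutative Noetherian local ring of Krull dimension d, C a semidualizing R-module, and M a nonzero finitely generated R-module. If M* = Hom_R(M,R) has finite C-injective dimension and Ext_R^i(M,R) = 0 for all 1 ≤ i ≤ d, then R is Cohen-Macaulay, C is a canonical module for R (i.e., C has finite injective dimension), and M is free. -/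
open CategoryTheory

noncomputable section

section ExtVanishing

variable {R : Type} [CommRing R]
  {M N A B D P : Type} [AddCommGroup M] [Module R M] [AddCommGroup N] [Module R N]
  [AddCommGroup A] [Module R A] [AddCommGroup B] [Module R B] [AddCommGroup D] [Module R D]
  [AddCommGroup P] [Module R P]

variable (R) in
/-- `Ext^i(M, N) = 0`, in terms of `CategoryTheory.Abelian.Ext`. -/
abbrev ExtVanishes (i : ℕ) (M N : Type) [AddCommGroup M] [Module R M]
    [AddCommGroup N] [Module R N] : Prop :=
  Subsingleton (Abelian.Ext (ModuleCat.of R M) (ModuleCat.of R N) i)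

theorem extVanishes_zero_iff : ExtVanishes R 0 M N ↔ Subsingleton (M →ₗ[R] N) :=
  (Abelian.Ext.addEquiv₀.trans ModuleCat.homAddEquiv).subsingleton_congr

theorem subsingleton_extMod_zero_iff :
    Subsingleton (extMod R 0 M N) ↔ Subsingleton (M →ₗ[R] N) := by
  let Q := projectiveResolution (ModuleCat.of R M)
  have e := Q.isoExt (R := R) 0 (ModuleCat.of R N)
  have h1 : Subsingleton (extMod R 0 M N) ↔
      (Q.complex.linearYonedaObj R (ModuleCat.of R N)).ExactAt 0 := by
    rw [HomologicalComplex.exactAt_iff_isZero_homology, ← e.isZero_iff,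
      ModuleCat.isZero_iff_subsingleton]
    rfl
  rw [h1, HomologicalComplex.exactAt_iff' _ 0 0 1 (by simp) (by simp),
    ShortComplex.moduleCat_exact_iff]
  have hd : Q.complex.d 0 0 = 0 := Q.complex.shape 0 0 (by simp)
  constructor
  · intro h
    refine subsingleton_of_forall_eq 0 fun φ => ?_
    let ψ : ((ChainComplex.single₀ (ModuleCat R)).obj (ModuleCat.of R M)).X 0 ⟶
      ModuleCat.of R N := ModuleCat.ofHom φ
    have h0 : Q.complex.d 1 0 ≫ Q.π.f 0 ≫ ψ = 0 := by
      rw [← Category.assoc, Q.complex_d_comp_π_f_zero, Limits.zero_comp]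
    obtain ⟨g, hg⟩ := h (Q.π.f 0 ≫ ψ) h0
    let g' : Q.complex.X 0 ⟶ ModuleCat.of R N := g
    have hg : Q.complex.d 0 0 ≫ g' = Q.π.f 0 ≫ ψ := hg
    rw [hd, Limits.zero_comp] at hg
    have := (cancel_epi (Q.π.f 0)).mp (hg.symm.trans Limits.comp_zero.symm)
    exact congrArg ModuleCat.Hom.hom this
  · intro h f hf
    have hf : Q.complex.d 1 0 ≫ f = 0 := hf
    refine ⟨0, ?_⟩
    let φ := Q.exact₀.gIsCokernel.desc (Limits.CokernelCofork.ofπ f hf)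
    have h2 : Q.π.f 0 ≫ φ = f :=
      Q.exact₀.gIsCokernel.fac (Limits.CokernelCofork.ofπ f hf) Limits.WalkingParallelPair.one
    have h3 : φ = 0 := ModuleCat.hom_ext (Subsingleton.elim (α := M →ₗ[R] N) _ _)
    rw [map_zero, ← h2, h3, Limits.comp_zero]
    rfl

theorem subsingleton_extMod_succ_iff (i : ℕ) :
    Subsingleton (extMod R (i + 1) M N) ↔ ExtVanishes R (i + 1) M N := by
  let Q := projectiveResolution (ModuleCat.of R M)
  have e := Q.isoExt (R := R) (i + 1) (ModuleCat.of R N)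
  have h1 : Subsingleton (extMod R (i + 1) M N) ↔
      (Q.complex.linearYonedaObj R (ModuleCat.of R N)).ExactAt (i + 1) := by
    rw [HomologicalComplex.exactAt_iff_isZero_homology, ← e.isZero_iff,
      ModuleCat.isZero_iff_subsingleton]
    rfl
  rw [h1, HomologicalComplex.exactAt_iff' _ i (i + 1) (i + 2) (by simp) (by simp),
    ShortComplex.moduleCat_exact_iff]
  constructor
  · intro h
    refine subsingleton_of_forall_eq 0 fun α => ?_
    obtain ⟨f, hf, rfl⟩ := Q.extMk_surjective α (i + 2) rfl
    rw [Q.extMk_eq_zero_iff f (i + 2) rfl hf i rfl]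
    exact h f hf
  · intro h f hf
    exact (Q.extMk_eq_zero_iff f (i + 2) rfl hf i rfl).mp (Subsingleton.elim _ _)

section Sequences

variable {f : A →ₗ[R] B} {g : B →ₗ[R] D}

theorem shortExact_of_exact (hfg : Function.Exact f g) (hf : Function.Injective f)
    (hg : Function.Surjective g) :
    (ModuleCat.shortComplexOfCompEqZero f g hfg.linearMap_comp_eq_zero).ShortExact :=
  ModuleCat.shortComplex_shortExact _ hfg hf hg

variable (hfg : Function.Exact f g) (hf : Function.Injective f) (hg : Function.Surjective g)
include hfg hf hg

theorem ExtVanishes.left_right {i : ℕ} (h₃ : ExtVanishes R i M D)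
    (h₂ : ExtVanishes R (i + 1) M B) : ExtVanishes R (i + 1) M A := by
  refine subsingleton_of_forall_eq 0 fun x => ?_
  obtain ⟨y, rfl⟩ := Abelian.Ext.covariant_sequence_exact₁ (ModuleCat.of R M)
    (shortExact_of_exact hfg hf hg) x (h₂.elim _ _) rfl
  rw [h₃.elim y 0, Abelian.Ext.zero_comp]

theorem ExtVanishes.right_right {i : ℕ} (h₂ : ExtVanishes R i M B)
    (h₁ : ExtVanishes R (i + 1) M A) : ExtVanishes R i M D := by
  refine subsingleton_of_forall_eq 0 fun x => ?_
  obtain ⟨y, rfl⟩ := Abelian.Ext.covariant_sequence_exact₃ (ModuleCat.of R M)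
    (shortExact_of_exact hfg hf hg) x rfl (h₁.elim _ _)
  rw [h₂.elim y 0, Abelian.Ext.zero_comp]

theorem ExtVanishes.exists_lift (h : ExtVanishes R 1 M A) (φ : M →ₗ[R] D) :
    ∃ ψ : M →ₗ[R] B, g ∘ₗ ψ = φ := by
  obtain ⟨y, hy⟩ := Abelian.Ext.covariant_sequence_exact₃ (ModuleCat.of R M)
    (shortExact_of_exact hfg hf hg) (Abelian.Ext.mk₀ (ModuleCat.ofHom φ)) rfl (h.elim _ _)
  obtain ⟨y, rfl⟩ := Abelian.Ext.addEquiv₀.symm.surjective y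
  refine ⟨y.hom, ?_⟩
  have : Abelian.Ext.mk₀ (y ≫ ModuleCat.ofHom g) = Abelian.Ext.mk₀ (ModuleCat.ofHom φ) := by
    rw [← hy, ← Abelian.Ext.mk₀_comp_mk₀]; rfl
  have := Abelian.Ext.addEquiv₀.symm.injective this
  exact congrArg ModuleCat.Hom.hom this

theorem ExtVanishes.one_left_right (h : ∀ φ : M →ₗ[R] D, ∃ ψ : M →ₗ[R] B, g ∘ₗ ψ = φ)
    (h₂ : ExtVanishes R 1 M B) : ExtVanishes R 1 M A := by
  refine subsingleton_of_forall_eq 0 fun x => ?_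
  have hS := shortExact_of_exact hfg hf hg
  obtain ⟨y, rfl⟩ := Abelian.Ext.covariant_sequence_exact₁ (ModuleCat.of R M)
    hS x (h₂.elim _ _) rfl
  obtain ⟨y, rfl⟩ := Abelian.Ext.addEquiv₀.symm.surjective y
  obtain ⟨ψ, hψ⟩ := h y.hom
  have : y = ModuleCat.ofHom ψ ≫ ModuleCat.ofHom g := by
    ext x; exact (LinearMap.congr_fun hψ x).symm
  change (Abelian.Ext.mk₀ y).comp _ _ = _
  rw [this, ← Abelian.Ext.mk₀_comp_mk₀]
  exact (Abelian.Ext.comp_assoc_of_second_deg_zero _ _ _ _).trans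
    (by erw [hS.comp_extClass]; simp)

theorem ExtVanishes.middle_left {i : ℕ} (h₁ : ExtVanishes R i A N) (h₃ : ExtVanishes R i D N) :
    ExtVanishes R i B N := by
  refine subsingleton_of_forall_eq 0 fun x => ?_
  obtain ⟨y, rfl⟩ := Abelian.Ext.contravariant_sequence_exact₂
    (shortExact_of_exact hfg hf hg) (ModuleCat.of R N) x (h₁.elim _ _)
  rw [h₃.elim y 0, Abelian.Ext.comp_zero]

theorem ExtVanishes.right_left {i : ℕ} (h₁ : ExtVanishes R i A N)
    (h₂ : ExtVanishes R (i + 1) B N) : ExtVanishes R (i + 1) D N := by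
  refine subsingleton_of_forall_eq 0 fun x => ?_
  obtain ⟨y, rfl⟩ := Abelian.Ext.contravariant_sequence_exact₃
    (shortExact_of_exact hfg hf hg) (ModuleCat.of R N) x (h₂.elim _ _) (add_comm _ _)
  rw [h₁.elim y 0, Abelian.Ext.comp_zero]

theorem ExtVanishes.left_left {i : ℕ} (h₂ : ExtVanishes R i B N)
    (h₃ : ExtVanishes R (i + 1) D N) : ExtVanishes R i A N := by
  refine subsingleton_of_forall_eq 0 fun x => ?_
  obtain ⟨y, rfl⟩ := Abelian.Ext.contravariant_sequence_exact₁
    (shortExact_of_exact hfg hf hg) (ModuleCat.of R N) x (add_comm _ _) (h₃.elim _ _)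
  rw [h₂.elim y 0, Abelian.Ext.comp_zero]

theorem ExtVanishes.exists_extend (h : ExtVanishes R 1 D N) (φ : A →ₗ[R] N) :
    ∃ ψ : B →ₗ[R] N, ψ ∘ₗ f = φ := by
  obtain ⟨y, hy⟩ := Abelian.Ext.contravariant_sequence_exact₁
    (shortExact_of_exact hfg hf hg) (ModuleCat.of R N) (Abelian.Ext.mk₀ (ModuleCat.ofHom φ))
    rfl (h.elim _ _)
  obtain ⟨y, rfl⟩ := Abelian.Ext.addEquiv₀.symm.surjective y
  refine ⟨y.hom, ?_⟩
  have : Abelian.Ext.mk₀ (ModuleCat.ofHom f ≫ y) = Abelian.Ext.mk₀ (ModuleCat.ofHom φ) := by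
    rw [← hy, ← Abelian.Ext.mk₀_comp_mk₀]; rfl
  have := Abelian.Ext.addEquiv₀.symm.injective this
  exact congrArg ModuleCat.Hom.hom this

theorem ExtVanishes.one_right_left (h : ∀ φ : A →ₗ[R] N, ∃ ψ : B →ₗ[R] N, ψ ∘ₗ f = φ)
    (h₂ : ExtVanishes R 1 B N) : ExtVanishes R 1 D N := by
  refine subsingleton_of_forall_eq 0 fun x => ?_
  have hS := shortExact_of_exact hfg hf hg
  obtain ⟨y, rfl⟩ := Abelian.Ext.contravariant_sequence_exact₃
    hS (ModuleCat.of R N) x (h₂.elim _ _) (add_zero 1)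
  obtain ⟨y, rfl⟩ := Abelian.Ext.addEquiv₀.symm.surjective y
  obtain ⟨ψ, hψ⟩ := h y.hom
  have : y = ModuleCat.ofHom f ≫ ModuleCat.ofHom ψ := by
    ext x; exact (LinearMap.congr_fun hψ x).symm
  change hS.extClass.comp (Abelian.Ext.mk₀ y) _ = _
  rw [this, ← Abelian.Ext.mk₀_comp_mk₀]
  exact (Abelian.Ext.comp_assoc_of_second_deg_zero _ _ _ _).symm.trans
    (by erw [hS.extClass_comp]; simp)

end Sequences

theorem ExtVanishes.retract_right {i : ℕ} (h : ExtVanishes R i M N) (f : P →ₗ[R] N)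
    (g : N →ₗ[R] P) (hgf : g ∘ₗ f = LinearMap.id) : ExtVanishes R i M P := by
  refine subsingleton_of_forall_eq 0 fun x => ?_
  have h1 : ModuleCat.ofHom f ≫ ModuleCat.ofHom g = 𝟙 (ModuleCat.of R P) := by
    rw [← ModuleCat.ofHom_comp, hgf]; rfl
  rw [← Abelian.Ext.comp_mk₀_id x, ← h1, ← Abelian.Ext.mk₀_comp_mk₀,
    ← Abelian.Ext.comp_assoc_of_second_deg_zero, h.elim (x.comp _ _) 0, Abelian.Ext.zero_comp]

theorem ExtVanishes.retract_left {i : ℕ} (h : ExtVanishes R i N M) (f : P →ₗ[R] N)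
    (g : N →ₗ[R] P) (hgf : g ∘ₗ f = LinearMap.id) : ExtVanishes R i P M := by
  refine subsingleton_of_forall_eq 0 fun x => ?_
  have h1 : ModuleCat.ofHom f ≫ ModuleCat.ofHom g = 𝟙 (ModuleCat.of R P) := by
    rw [← ModuleCat.ofHom_comp, hgf]; rfl
  rw [← Abelian.Ext.mk₀_id_comp x, ← h1, ← Abelian.Ext.mk₀_comp_mk₀,
    Abelian.Ext.comp_assoc_of_second_deg_zero, h.elim (Abelian.Ext.comp _ x _) 0,
    Abelian.Ext.comp_zero]

theorem ExtVanishes.congr_right {i : ℕ} (h : ExtVanishes R i M N) (e : N ≃ₗ[R] P) :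
    ExtVanishes R i M P :=
  h.retract_right e.symm.toLinearMap e.toLinearMap (by ext; simp)

theorem ExtVanishes.congr_left {i : ℕ} (h : ExtVanishes R i N M) (e : N ≃ₗ[R] P) :
    ExtVanishes R i P M :=
  h.retract_left e.symm.toLinearMap e.toLinearMap (by ext; simp)

theorem ExtVanishes.of_projective [Module.Projective R P] (i : ℕ) :
    ExtVanishes R (i + 1) P N :=
  subsingleton_of_forall_eq 0 fun x => Abelian.Ext.eq_zero_of_projective x

theorem ExtVanishes.of_injective [Module.Injective R P] (i : ℕ) :
    ExtVanishes R (i + 1) N P := by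
  have : Injective (ModuleCat.of R P) := Module.injective_object_of_injective_module R P
  exact subsingleton_of_forall_eq 0 fun x => Abelian.Ext.eq_zero_of_injective x

end ExtVanishing

section Faithful

variable {R : Type} [CommRing R] [IsNoetherianRing R] {C : Type} [AddCommGroup C] [Module R C]
  [Module.Finite R C] (hC : Function.Injective (LinearMap.lsmul R C))
  {L N Y : Type} [AddCommGroup L] [Module R L] [AddCommGroup N] [Module R N]
  [AddCommGroup Y] [Module R Y]
include hC

theorem subsingleton_of_subsingleton_linearMap [Subsingleton (C →ₗ[R] Y)] : Subsingleton Y := by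
  refine subsingleton_of_forall_eq 0 fun y => ?_
  have : Subsingleton (C →ₗ[R] (R ∙ y)) := by
    refine subsingleton_of_forall_eq 0 fun φ => ?_
    have h0 := Subsingleton.elim ((R ∙ y).subtype ∘ₗ φ) 0
    ext c
    exact LinearMap.congr_fun h0 c
  obtain ⟨r, hr, hreg⟩ := IsSMulRegular.subsingleton_linearMap_iff.mp this
  have hr0 : r = 0 := hC (by ext c; simpa using Module.mem_annihilator.mp hr c)
  have := @hreg ⟨y, Submodule.mem_span_singleton_self y⟩ 0 (by simp [hr0])
  exact congrArg Subtype.val this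

theorem subsingleton_of_subsingleton_tensorProduct [Subsingleton (TensorProduct R C Y)] :
    Subsingleton Y := by
  have : Subsingleton (CharacterModule (TensorProduct R C Y)) :=
    subsingleton_of_forall_eq 0 fun χ => by
      ext x; rw [Subsingleton.elim x 0, map_zero, map_zero]
  have : Subsingleton (C →ₗ[R] CharacterModule Y) := CharacterModule.homEquiv.subsingleton
  have := subsingleton_of_subsingleton_linearMap hC (Y := CharacterModule Y)
  exact subsingleton_of_forall_eq 0 fun y =>
    CharacterModule.eq_zero_of_character_apply fun c => by
      rw [Subsingleton.elim c 0]; rfl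

theorem surjective_of_lTensor_surjective_s12 (g : N →ₗ[R] Y)
    (hg : Function.Surjective (g.lTensor C)) : Function.Surjective g := by
  have h0 : (g.range.mkQ).lTensor C = 0 := by
    rw [← LinearMap.cancel_right hg, ← LinearMap.lTensor_comp]
    simp [LinearMap.range_mkQ_comp]
  have h1 := LinearMap.lTensor_surjective C g.range.mkQ_surjective
  have : Subsingleton (TensorProduct R C (Y ⧸ g.range)) :=
    subsingleton_of_forall_eq 0 fun x => by
      obtain ⟨y, rfl⟩ := h1 x
      rw [h0, LinearMap.zero_apply]
  have := subsingleton_of_subsingleton_tensorProduct hC (Y := Y ⧸ g.range)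
  rw [← LinearMap.range_eq_top]
  exact Submodule.Quotient.subsingleton_iff.mp this

end Faithful

section Character

variable {R : Type} [CommRing R] {A B C D : Type} [AddCommGroup A] [Module R A]
  [AddCommGroup B] [Module R B] [AddCommGroup C] [Module R C] [AddCommGroup D] [Module R D]

theorem CharacterModule.dual_exact {f : A →ₗ[R] B} {g : B →ₗ[R] D} (hfg : Function.Exact f g)
    (hg : Function.Surjective g) :
    Function.Exact (CharacterModule.dual g) (CharacterModule.dual f) := by
  intro χ
  constructor
  · intro h
    have hker : ∀ b, g b = 0 → χ b = 0 := fun b hb => by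
      obtain ⟨a, rfl⟩ := (hfg b).mp hb
      exact DFunLike.congr_fun h a
    refine ⟨QuotientAddGroup.lift (G := B) g.toAddMonoidHom.ker χ hker |>.comp
      (QuotientAddGroup.quotientKerEquivOfSurjective g.toAddMonoidHom hg).symm.toAddMonoidHom, ?_⟩
    ext b
    have : (QuotientAddGroup.quotientKerEquivOfSurjective g.toAddMonoidHom hg).symm (g b)
      = (b : B ⧸ g.toAddMonoidHom.ker) := by
      rw [AddEquiv.symm_apply_eq]; rfl
    change QuotientAddGroup.lift g.toAddMonoidHom.ker χ hker
      ((QuotientAddGroup.quotientKerEquivOfSurjective g.toAddMonoidHom hg).symm (g b)) = χ b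
    rw [this]; rfl
  · rintro ⟨χ, rfl⟩
    ext a
    change χ (g (f a)) = 0
    rw [hfg.apply_apply_eq_zero, map_zero]

theorem lTensor_injective_of_extVanishes {f : A →ₗ[R] B} {g : B →ₗ[R] D}
    (hfg : Function.Exact f g) (hf : Function.Injective f) (hg : Function.Surjective g)
    (h : ExtVanishes R 1 C (CharacterModule D)) : Function.Injective (f.lTensor C) := by
  rw [← CharacterModule.dual_surjective_iff_injective]
  intro χ
  obtain ⟨ψ, hψ⟩ := h.exists_lift (CharacterModule.dual_exact hfg hg)
    (CharacterModule.dual_injective_of_surjective g hg)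
    (CharacterModule.dual_surjective_of_injective f hf) (CharacterModule.homEquiv.symm χ)
  refine ⟨CharacterModule.homEquiv ψ, ?_⟩
  rw [← CharacterModule.homEquiv.symm.injective.eq_iff, ← hψ]
  ext c a
  rfl

end Character

section HomEval

variable {R : Type} [CommRing R]

/-- The evaluation map `A ⊗ Hom(B, I) → Hom(Hom(A, B), I)`. -/
def tensorHomEval (A B I : Type) [AddCommGroup A] [Module R A] [AddCommGroup B] [Module R B]
    [AddCommGroup I] [Module R I] :
    TensorProduct R A (B →ₗ[R] I) →ₗ[R] ((A →ₗ[R] B) →ₗ[R] I) :=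
  TensorProduct.lift (LinearMap.mk₂ R (fun a h => h ∘ₗ LinearMap.applyₗ a)
    (fun _ _ _ => by ext; simp) (fun _ _ _ => by ext; simp)
    (fun _ _ _ => by ext; simp) (fun _ _ _ => by ext; simp))

variable {A A' B I : Type} [AddCommGroup A] [Module R A] [AddCommGroup A'] [Module R A']
  [AddCommGroup B] [Module R B] [AddCommGroup I] [Module R I]

@[simp]
theorem tensorHomEval_tmul (a : A) (h : B →ₗ[R] I) (φ : A →ₗ[R] B) :
    tensorHomEval A B I (a ⊗ₜ h) φ = h (φ a) := rfl

theorem tensorHomEval_rTensor (f : A →ₗ[R] A') (x : TensorProduct R A (B →ₗ[R] I))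
    (φ : A' →ₗ[R] B) :
    tensorHomEval A' B I (f.rTensor _ x) φ = tensorHomEval A B I x (φ ∘ₗ f) := by
  induction x with
  | zero => simp
  | tmul a h => simp
  | add x y hx hy => simp [hx, hy]

theorem tensorHomEval_bijective_pi (n : ℕ) :
    Function.Bijective (tensorHomEval (R := R) (Fin n → R) B I) := by
  let inv (Ψ : ((Fin n → R) →ₗ[R] B) →ₗ[R] I) : TensorProduct R (Fin n → R) (B →ₗ[R] I) :=
    ∑ i, Pi.single i 1 ⊗ₜ (Ψ ∘ₗ LinearMap.lcomp R B (LinearMap.proj i) ∘ₗ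
      (LinearMap.ringLmapEquivSelf R R B).symm.toLinearMap)
  have hadd : ∀ Ψ Ψ', inv (Ψ + Ψ') = inv Ψ + inv Ψ' := fun Ψ Ψ' => by
    simp only [inv, ← Finset.sum_add_distrib, ← TensorProduct.tmul_add]
    rfl
  refine ⟨Function.LeftInverse.injective (g := inv) fun x => ?_,
    Function.RightInverse.surjective (g := inv) fun Ψ => ?_⟩
  · induction x with
    | zero => simp [inv]
    | tmul a h =>
      have : ∀ i, (tensorHomEval (Fin n → R) B I (a ⊗ₜ[R] h)) ∘ₗ
        LinearMap.lcomp R B (LinearMap.proj i) ∘ₗ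
        (LinearMap.ringLmapEquivSelf R R B).symm.toLinearMap = a i • h := fun i => by
        ext b; simp
      simp only [inv, this, TensorProduct.tmul_smul, TensorProduct.smul_tmul',
        ← TensorProduct.sum_tmul]
      congr 1
      ext i
      simp [Finset.sum_apply, Pi.single_apply]
    | add x y hx hy => rw [map_add, hadd, hx, hy]
  · ext φ
    simp only [inv, map_sum, LinearMap.sum_apply, tensorHomEval_tmul, LinearMap.comp_apply]
    rw [← map_sum]
    congr 1
    apply (Pi.basisFun R (Fin n)).ext
    intro i
    simp [LinearMap.sum_apply, Pi.single_apply]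

variable [Module.Injective R I]

theorem tensorHomEval_surjective [Module.Finite R A] :
    Function.Surjective (tensorHomEval (R := R) A B I) := by
  obtain ⟨n, p, hp⟩ := Module.Finite.exists_fin' R A
  intro Ψ
  obtain ⟨Φ, hΦ⟩ := Module.Injective.extension_property R _ _ _ (LinearMap.lcomp R B p)
    (LinearMap.lcomp_injective_of_surjective p hp) Ψ
  obtain ⟨x, rfl⟩ := (tensorHomEval_bijective_pi n).2 Φ
  refine ⟨p.rTensor _ x, ?_⟩
  ext φ
  rw [tensorHomEval_rTensor, ← hΦ]
  rfl

theorem tensorHomEval_injective [IsNoetherianRing R] [Module.Finite R A] :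
    Function.Injective (tensorHomEval (R := R) A B I) := by
  obtain ⟨n, p, hp⟩ := Module.Finite.exists_fin' R A
  rw [injective_iff_map_eq_zero]
  intro x hx
  obtain ⟨y, rfl⟩ := LinearMap.rTensor_surjective _ hp x
  let res := LinearMap.lcomp R B p.ker.subtype
  have hker : res.ker ≤ (tensorHomEval (Fin n → R) B I y).ker := fun φ hφ => by
    obtain ⟨ψ, rfl⟩ : ∃ ψ : A →ₗ[R] B, ψ ∘ₗ p = φ := by
      refine ⟨p.ker.liftQ φ (fun v hv => LinearMap.congr_fun hφ ⟨v, hv⟩) ∘ₗ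
        (p.quotKerEquivOfSurjective hp).symm.toLinearMap, ?_⟩
      ext v
      have : (p.quotKerEquivOfSurjective hp).symm (p (Pi.single v 1)) =
          Submodule.Quotient.mk (Pi.single v 1) := by
        rw [LinearEquiv.symm_apply_eq]; rfl
      simp only [LinearMap.comp_apply, LinearEquiv.coe_coe, LinearMap.single_apply, this]
      rfl
    rw [LinearMap.mem_ker, ← tensorHomEval_rTensor, hx, LinearMap.zero_apply]
  obtain ⟨Φ, hΦ⟩ := Module.Injective.extension_property R _ _ _ (res.ker.liftQ res le_rfl)
    (LinearMap.ker_eq_bot.mp (Submodule.ker_liftQ_eq_bot' _ _ rfl))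
    (res.ker.liftQ (tensorHomEval (Fin n → R) B I y) hker)
  obtain ⟨z, rfl⟩ := tensorHomEval_surjective (A := p.ker) Φ
  have hyz : y = p.ker.subtype.rTensor _ z := by
    apply (tensorHomEval_bijective_pi n).1
    ext φ
    rw [tensorHomEval_rTensor]
    exact (LinearMap.congr_fun hΦ (Submodule.Quotient.mk φ)).symm
  rw [hyz, ← LinearMap.comp_apply, ← LinearMap.rTensor_comp]
  have : p ∘ₗ p.ker.subtype = 0 := by ext v; exact v.2
  simp [this]

theorem rTensor_hom_injective [IsNoetherianRing R] {K : Type} [AddCommGroup K] [Module R K]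
    [Module.Finite R K] {f : K →ₗ[R] A'} {g : A' →ₗ[R] A} (h : ExtVanishes R 1 A B)
    (hfg : Function.Exact f g) (hf : Function.Injective f) (hg : Function.Surjective g) :
    Function.Injective (f.rTensor (B →ₗ[R] I)) := by
  rw [injective_iff_map_eq_zero]
  intro x hx
  apply tensorHomEval_injective
  rw [map_zero]
  ext φ
  obtain ⟨ψ, rfl⟩ := h.exists_extend hfg hf hg φ
  rw [← tensorHomEval_rTensor, hx, map_zero, LinearMap.zero_apply, LinearMap.zero_apply]

/-- If `Ext^i(A, B) = 0` for `i ≥ 1`, then `Tor_i(A, Hom(B, I)) = 0` for `i ≥ 1`, in terms of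
character modules. -/
theorem extVanishes_character_hom [IsNoetherianRing R] (i : ℕ) :
    ∀ (A : Type) [AddCommGroup A] [Module R A] [Module.Finite R A],
    (∀ j, ExtVanishes R (j + 1) A B) →
    ExtVanishes R (i + 1) A (CharacterModule (B →ₗ[R] I)) := by
  induction i with
  | zero =>
    intro A _ _ _ h
    obtain ⟨n, p, hp⟩ := Module.Finite.exists_fin' R A
    refine ExtVanishes.one_right_left p.exact_subtype_ker_map p.ker.injective_subtype hp ?_
      (.of_projective 0)
    exact rTensor_injective_iff_lcomp_surjective.mp
      (rTensor_hom_injective (h 0) p.exact_subtype_ker_map p.ker.injective_subtype hp)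
  | succ i ih =>
    intro A _ _ _ h
    obtain ⟨n, p, hp⟩ := Module.Finite.exists_fin' R A
    exact (ih p.ker fun j => ExtVanishes.left_left p.exact_subtype_ker_map
      p.ker.injective_subtype hp (.of_projective j) (h (j + 1))).right_left
      p.exact_subtype_ker_map p.ker.injective_subtype hp (.of_projective (i + 1))

end HomEval

section BassAuslander

open scoped Pointwise

variable {R : Type} [CommRing R]

theorem IsSemidualizing.extVanishes {C : Type} [AddCommGroup C] [Module R C]
    (hC : IsSemidualizing R C) (i : ℕ) : ExtVanishes R (i + 1) C C :=
  (subsingleton_extMod_succ_iff i).mp (hC.ext_vanish (i + 1) (Nat.le_add_left 1 i))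

/-- The evaluation map `C ⊗ Hom(C, X) → X`. -/
def tensorHomApply (C X : Type) [AddCommGroup C] [Module R C] [AddCommGroup X] [Module R X] :
    TensorProduct R C (C →ₗ[R] X) →ₗ[R] X :=
  TensorProduct.lift LinearMap.applyₗ

/-- Membership in the Bass class of `C`, with the vanishing of `Tor` expressed through character
modules. -/
structure IsBass (R : Type) [CommRing R] (C X : Type) [AddCommGroup C] [Module R C]
    [AddCommGroup X] [Module R X] : Prop where
  bijective : Function.Bijective (tensorHomApply (R := R) C X)
  tor_vanish : ∀ i, ExtVanishes R (i + 1) C (CharacterModule (C →ₗ[R] X))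
  ext_vanish : ∀ i, ExtVanishes R (i + 1) C X

/-- Membership in the Auslander class of `C`, with the vanishing of `Tor` expressed through
character modules. -/
structure IsAuslander (R : Type) [CommRing R] (C N : Type) [AddCommGroup C] [Module R C]
    [AddCommGroup N] [Module R N] : Prop where
  bijective : Function.Bijective ((TensorProduct.mk R C N).flip)
  tor_vanish : ∀ i, ExtVanishes R (i + 1) C (CharacterModule N)
  ext_vanish : ∀ i, ExtVanishes R (i + 1) C (TensorProduct R C N)

variable {C N X Y I : Type} [AddCommGroup C] [Module R C] [AddCommGroup N] [Module R N]
  [AddCommGroup X] [Module R X] [AddCommGroup Y] [Module R Y] [AddCommGroup I] [Module R I]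

@[simp]
theorem tensorHomApply_tmul (c : C) (φ : C →ₗ[R] X) : tensorHomApply C X (c ⊗ₜ[R] φ) = φ c := rfl

theorem tensorHomApply_lTensor_comp (f : X →ₗ[R] Y) (x : TensorProduct R C (C →ₗ[R] X)) :
    tensorHomApply C Y ((f.compRight R).lTensor C x) = f (tensorHomApply C X x) := by
  induction x with
  | zero => simp
  | tmul a h => simp
  | add x y hx hy => simp [hx, hy]

variable [IsNoetherianRing R] [Module.Finite R C] (hC : IsSemidualizing R C)
include hC

theorem IsSemidualizing.isBass_of_injective [Module.Injective R I] : IsBass R C I where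
  bijective := by
    have h1 : Function.Bijective (tensorHomEval (R := R) C C I) :=
      ⟨tensorHomEval_injective, tensorHomEval_surjective⟩
    have h2 : ∀ x, tensorHomApply (R := R) C I x =
        tensorHomEval C C I x (LinearMap.id : C →ₗ[R] C) := fun x => by
      induction x with
      | zero => simp
      | tmul a h => simp
      | add x y hx hy => simp [hx, hy]
    have h3 : ∀ φ : C →ₗ[R] C, ∃ r : R, φ = r • (LinearMap.id : C →ₗ[R] C) := fun φ => by
      obtain ⟨r, rfl⟩ := hC.bijective.2 φ
      exact ⟨r, by ext; simp⟩
    constructor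
    · intro x y hxy
      apply h1.1
      ext φ
      obtain ⟨r, rfl⟩ := h3 φ
      rw [map_smul, map_smul, ← h2, ← h2, hxy]
    · intro z
      let e := LinearEquiv.ofBijective _ hC.bijective
      obtain ⟨x, hx⟩ := h1.2 (LinearMap.toSpanSingleton R I z ∘ₗ e.symm.toLinearMap)
      refine ⟨x, ?_⟩
      have : e.symm LinearMap.id = 1 := by
        rw [LinearEquiv.symm_apply_eq]; ext; simp [e]
      simp [h2, hx, this]
  tor_vanish i := extVanishes_character_hom i C hC.extVanishes
  ext_vanish i := .of_injective i

theorem IsBass.of_exact {f : X →ₗ[R] I} {g : I →ₗ[R] Y} (hfg : Function.Exact f g)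
    (hf : Function.Injective f) (hg : Function.Surjective g) (hI : IsBass R C I)
    (hY : IsBass R C Y) : IsBass R C X := by
  let F : (C →ₗ[R] X) →ₗ[R] (C →ₗ[R] I) := f.compRight R
  let G : (C →ₗ[R] I) →ₗ[R] (C →ₗ[R] Y) := g.compRight R
  have hG : Function.Surjective G := by
    refine surjective_of_lTensor_surjective_s12 hC.bijective.1 G fun y => ?_
    obtain ⟨z, hz⟩ := hg (tensorHomApply C Y y)
    obtain ⟨x, rfl⟩ := hI.bijective.2 z
    exact ⟨x, hY.bijective.1 ((tensorHomApply_lTensor_comp g x).trans hz)⟩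
  have hF : Function.Injective F := fun φ ψ h => by
    ext c; exact hf (LinearMap.congr_fun h c)
  have hFG : Function.Exact F G := fun φ => by
    constructor
    · intro h
      have h' : ∀ c, φ c ∈ f.range := fun c => (hfg _).mp (LinearMap.congr_fun h c)
      refine ⟨(LinearEquiv.ofInjective f hf).symm.toLinearMap ∘ₗ φ.codRestrict _ h', ?_⟩
      ext c
      exact congrArg Subtype.val
        ((LinearEquiv.ofInjective f hf).apply_symm_apply (φ.codRestrict _ h' c))
    · rintro ⟨φ, rfl⟩
      ext c
      exact hfg.apply_apply_eq_zero _
  refine ⟨⟨?_, ?_⟩, fun i => ?_, fun i => ?_⟩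
  · have h1 := lTensor_injective_of_extVanishes hFG hF hG (hY.tor_vanish 0)
    intro x y hxy
    refine h1 (hI.bijective.1 ?_)
    rw [tensorHomApply_lTensor_comp, tensorHomApply_lTensor_comp, hxy]
  · intro x
    obtain ⟨y, hy⟩ := hI.bijective.2 (f x)
    have : G.lTensor C y = 0 := by
      apply hY.bijective.1
      rw [tensorHomApply_lTensor_comp, hy, map_zero, hfg.apply_apply_eq_zero]
    obtain ⟨z, rfl⟩ := (lTensor_exact C hFG hG y).mp this
    refine ⟨z, hf ?_⟩
    rw [← tensorHomApply_lTensor_comp, hy]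
  · exact (hI.tor_vanish i).right_right (CharacterModule.dual_exact hFG hG)
      (CharacterModule.dual_injective_of_surjective _ hG)
      (CharacterModule.dual_surjective_of_injective _ hF) (hY.tor_vanish (i + 1))
  · cases i with
    | zero => exact (hI.ext_vanish 0).one_left_right hfg hf hg hG
    | succ i => exact (hY.ext_vanish i).left_right hfg hf hg (hI.ext_vanish (i + 1))

theorem IsSemidualizing.isBass_of_extVanishes (n : ℕ) :
    ∀ (X : Type) [AddCommGroup X] [Module R X],
    (∀ (L : Type) [AddCommGroup L] [Module R L] (i : ℕ), n < i → ExtVanishes R i L X) →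
    IsBass R C X := by
  induction n with
  | zero =>
    intro X _ _ h
    have : Module.Injective R X := ⟨fun A B _ _ _ _ f hf φ => by
      obtain ⟨ψ, hψ⟩ := (h (B ⧸ f.range) 1 one_pos).exists_extend f.exact_map_mkQ_range hf
        (Submodule.mkQ_surjective _) φ
      exact ⟨ψ, fun x => LinearMap.congr_fun hψ x⟩⟩
    exact hC.isBass_of_injective
  | succ n ih =>
    intro X _ _ h
    obtain ⟨J⟩ := EnoughInjectives.presentation (ModuleCat.of R X)
    have : Injective J.J := J.injective
    have : Module.Injective R J.J := Module.injective_module_of_injective_object R J.J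
    have hf : Function.Injective J.f.hom := (ModuleCat.mono_iff_injective J.f).mp J.mono
    refine hC.isBass_of_injective.of_exact hC J.f.hom.exact_map_mkQ_range hf
      (Submodule.mkQ_surjective _) (ih _ fun L _ _ i hi => ?_)
    obtain ⟨i, rfl⟩ := Nat.exists_eq_succ_of_ne_zero (Nat.ne_of_gt (Nat.zero_lt_of_lt hi))
    exact (ExtVanishes.of_injective i).right_right J.f.hom.exact_map_mkQ_range hf
      (Submodule.mkQ_surjective _) (h L (i + 2) (by omega))

theorem IsBass.isAuslander (h : IsBass R C (TensorProduct R C N)) : IsAuslander R C N := by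
  let μ : N →ₗ[R] (C →ₗ[R] TensorProduct R C N) := (TensorProduct.mk R C N).flip
  have hμ : ∀ x, tensorHomApply C _ (μ.lTensor C x) = x := fun x => by
    induction x with
    | zero => simp
    | tmul a h => simp [μ]
    | add x y hx hy => simp [hx, hy]
  have hinj : Function.Injective (μ.lTensor C) := Function.LeftInverse.injective hμ
  have hsurj : Function.Surjective μ := by
    refine surjective_of_lTensor_surjective_s12 hC.bijective.1 μ fun y => ?_
    exact ⟨tensorHomApply C _ y, h.bijective.1 (hμ _)⟩
  have hμinj : Function.Injective μ := by
    have h1 := lTensor_injective_of_extVanishes μ.exact_subtype_ker_map μ.ker.injective_subtype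
      hsurj (h.tor_vanish 0)
    have : Subsingleton (TensorProduct R C μ.ker) := subsingleton_of_forall_eq 0 fun x => by
      apply h1
      apply hinj
      rw [map_zero, map_zero, ← LinearMap.comp_apply, ← LinearMap.lTensor_comp]
      have : μ ∘ₗ μ.ker.subtype = 0 := by ext1 x; exact x.2
      rw [this, LinearMap.lTensor_zero, LinearMap.zero_apply]
    have := subsingleton_of_subsingleton_tensorProduct hC.bijective.1 (Y := μ.ker)
    exact LinearMap.ker_eq_bot.mp (Submodule.subsingleton_iff_eq_bot.mp this)
  refine ⟨⟨hμinj, hsurj⟩, fun i => ?_, h.ext_vanish⟩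
  exact (h.tor_vanish i).congr_right
    (CharacterModule.congr (LinearEquiv.ofBijective μ ⟨hμinj, hsurj⟩).symm)

theorem IsAuslander.isSMulRegular (h : IsAuslander R C N) {r : R} (hr : IsSMulRegular N r) :
    IsSMulRegular (TensorProduct R C N) r := by
  have : Subsingleton (C →ₗ[R] (LinearMap.lsmul R (TensorProduct R C N) r).ker) := by
    refine subsingleton_of_forall_eq 0 fun φ => ?_
    obtain ⟨n, hn⟩ := h.bijective.2 (Submodule.subtype _ ∘ₗ φ)
    have : r • n = 0 := h.bijective.1 <| by
      rw [map_smul, hn, map_zero]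
      ext c
      exact (φ c).2
    have hn0 : n = 0 := hr (this.trans (smul_zero r).symm)
    ext c
    rw [hn0, map_zero] at hn
    exact (LinearMap.congr_fun hn c).symm
  have := subsingleton_of_subsingleton_linearMap hC.bijective.1
    (Y := (LinearMap.lsmul R (TensorProduct R C N) r).ker)
  exact LinearMap.ker_eq_bot.mp (Submodule.subsingleton_iff_eq_bot.mp this)

theorem IsAuslander.quotSMulTop (h : IsAuslander R C N) {r : R} (hr : IsSMulRegular N r) :
    IsAuslander R C (QuotSMulTop r N) := by
  have hex := LinearMap.exact_lsmul_mkQ_smul_top N r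
  have hq := (r • (⊤ : Submodule R N)).mkQ_surjective
  have hinj : Function.Injective (LinearMap.lsmul R N r) := hr
  have hXinj : Function.Injective ((LinearMap.lsmul R N r).lTensor C) := by
    have : (LinearMap.lsmul R N r).lTensor C = LinearMap.lsmul R (TensorProduct R C N) r := by
      ext c n; simp
    rw [this]
    exact h.isSMulRegular hC hr
  have hXex := lTensor_exact C hex hq
  have hXq := LinearMap.lTensor_surjective C hq
  have hsm : ∀ x, (LinearMap.lsmul R N r).lTensor C x = r • x := fun x => by
    have : (LinearMap.lsmul R N r).lTensor C = LinearMap.lsmul R (TensorProduct R C N) r := by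
      ext c n; simp
    rw [this]; rfl
  refine ⟨⟨?_, ?_⟩, fun i => ?_, fun i => ?_⟩
  · rw [injective_iff_map_eq_zero]
    intro y hy
    obtain ⟨n, rfl⟩ := hq y
    have h1 : ∀ c : C, c ⊗ₜ[R] n ∈ ((LinearMap.lsmul R N r).lTensor C).range := fun c =>
      (hXex _).mp (LinearMap.congr_fun hy c)
    let e := LinearEquiv.ofInjective _ hXinj
    obtain ⟨n', hn'⟩ := h.bijective.2
      (e.symm.toLinearMap ∘ₗ ((TensorProduct.mk R C N).flip n).codRestrict _ h1)
    have : r • n' = n := h.bijective.1 <| by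
      rw [map_smul, hn']
      ext c
      rw [LinearMap.smul_apply, ← hsm]
      exact congrArg Subtype.val (e.apply_symm_apply _)
    rw [← this]
    exact hex.apply_apply_eq_zero n'
  · intro φ
    obtain ⟨ψ, rfl⟩ := (h.ext_vanish 0).exists_lift hXex hXinj hXq φ
    obtain ⟨n, rfl⟩ := h.bijective.2 ψ
    exact ⟨Submodule.mkQ _ n, rfl⟩
  · have hd := CharacterModule.dual_exact hex hq
    have hd1 := CharacterModule.dual_injective_of_surjective _ hq
    have hd2 := CharacterModule.dual_surjective_of_injective _ hinj
    cases i with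
    | zero =>
      refine (h.tor_vanish 0).one_left_right hd hd1 hd2 fun φ => ?_
      obtain ⟨χ, hχ⟩ := CharacterModule.dual_surjective_of_injective _ hXinj
        (CharacterModule.homEquiv φ)
      refine ⟨CharacterModule.homEquiv.symm χ, CharacterModule.homEquiv.injective ?_⟩
      rw [← hχ, ← LinearEquiv.eq_symm_apply]
      ext c n
      rfl
    | succ i => exact (h.tor_vanish i).left_right hd hd1 hd2 (h.tor_vanish (i + 1))
  · exact (h.ext_vanish i).right_right hXex hXinj hXq (h.ext_vanish (i + 1))

theorem IsAuslander.isWeaklyRegular_tensorProduct (rs : List R) :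
    ∀ (N : Type) [AddCommGroup N] [Module R N], IsAuslander R C N →
    RingTheory.Sequence.IsWeaklyRegular N rs →
    RingTheory.Sequence.IsWeaklyRegular (TensorProduct R C N) rs := by
  induction rs with
  | nil => intros; exact .nil _ _
  | cons r rs ih =>
    intro N _ _ h hrs
    rw [RingTheory.Sequence.isWeaklyRegular_cons_iff] at hrs ⊢
    exact ⟨h.isSMulRegular hC hrs.1,
      ((QuotSMulTop.tensorQuotSMulTopEquivQuotSMulTop r C N).isWeaklyRegular_congr rs).mp
        (ih _ (h.quotSMulTop hC hrs.1) hrs.2)⟩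

end BassAuslander

section RegularSequences

open scoped Pointwise

open RingTheory.Sequence

variable {R : Type} [CommRing R]

section

variable {A M X L : Type} [AddCommGroup A] [Module R A] [AddCommGroup M] [Module R M]
  [AddCommGroup X] [Module R X] [AddCommGroup L] [Module R L]

theorem ext_smul_eq_zero_of_mem_annihilator {r : R} (hr : r ∈ Module.annihilator R L) {n : ℕ}
    (x : Abelian.Ext (ModuleCat.of R L) (ModuleCat.of R X) n) : r • x = 0 := by
  have h : r • 𝟙 (ModuleCat.of R L) = 0 := by
    ext l
    exact Module.mem_annihilator.mp hr l
  rw [← Abelian.Ext.mk₀_id_comp x, ← Abelian.Ext.smul_comp, ← Abelian.Ext.mk₀_smul, h,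
    Abelian.Ext.mk₀_zero, Abelian.Ext.zero_comp]

theorem exists_comp_extClass_of_mem_annihilator {r : R} (hr : r ∈ Module.annihilator R L)
    (hX : IsSMulRegular X r) :
    ∃ δ : Abelian.Ext (ModuleCat.of R (QuotSMulTop r X)) (ModuleCat.of R X) 1,
      ∀ {n : ℕ} (x : Abelian.Ext (ModuleCat.of R L) (ModuleCat.of R X) (n + 1)),
        ∃ y : Abelian.Ext (ModuleCat.of R L) (ModuleCat.of R (QuotSMulTop r X)) n,
          y.comp δ rfl = x := by
  have hS := shortExact_of_exact (LinearMap.exact_lsmul_mkQ_smul_top X r) hX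
    (Submodule.mkQ_surjective _)
  refine ⟨hS.extClass, fun {n} x => Abelian.Ext.covariant_sequence_exact₁ _ hS x ?_ rfl⟩
  have h : x.comp (Abelian.Ext.mk₀ (r • 𝟙 (ModuleCat.of R X))) (add_zero _) = 0 := by
    rw [Abelian.Ext.mk₀_smul, Abelian.Ext.comp_smul, Abelian.Ext.comp_mk₀_id,
      ext_smul_eq_zero_of_mem_annihilator hr]
  exact h

theorem extVanishes_of_lt_length (rs : List R) (hL : ∀ r ∈ rs, r ∈ Module.annihilator R L) :
    ∀ (X : Type) [AddCommGroup X] [Module R X], IsWeaklyRegular X rs →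
    ∀ i < rs.length, ExtVanishes R i L X := by
  induction rs with
  | nil => simp
  | cons r rs ih =>
    intro X _ _ hX i hi
    rw [isWeaklyRegular_cons_iff] at hX
    cases i with
    | zero =>
      rw [extVanishes_zero_iff]
      exact IsSMulRegular.linearMap_subsingleton_of_mem_annihilator hX.1 (hL r (by simp))
    | succ i =>
      refine subsingleton_of_forall_eq 0 fun x => ?_
      obtain ⟨δ, hδ⟩ := exists_comp_extClass_of_mem_annihilator (hL r (by simp)) hX.1
      obtain ⟨y, rfl⟩ := hδ x
      have := ih (fun r hr => hL r (by simp [hr])) _ hX.2 i (by simpa using hi)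
      rw [Subsingleton.elim y 0, Abelian.Ext.zero_comp]

theorem extVanishes_length_iff (rs : List R) (hL : ∀ r ∈ rs, r ∈ Module.annihilator R L) :
    ∀ (X : Type) [AddCommGroup X] [Module R X], IsWeaklyRegular X rs →
    (ExtVanishes R rs.length L X ↔
      Subsingleton (L →ₗ[R] X ⧸ (Ideal.ofList rs • ⊤ : Submodule R X))) := by
  induction rs with
  | nil =>
    intro X _ _ _
    rw [List.length_nil, extVanishes_zero_iff]
    exact (LinearEquiv.congrRight
      (Submodule.quotEquivOfEqBot _ (by simp)).symm).toEquiv.subsingleton_congr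
  | cons r rs ih =>
    intro X _ _ hX
    have hX' := (isWeaklyRegular_cons_iff X r rs).mp hX
    rw [(LinearEquiv.congrRight (Submodule.quotOfListConsSMulTopEquivQuotSMulTopInner X r
      rs)).toEquiv.subsingleton_congr, ← ih (fun r hr => hL r (by simp [hr])) _ hX'.2]
    constructor
    · intro h
      exact (extVanishes_of_lt_length (r :: rs) hL X hX rs.length (by simp)).right_right
        (LinearMap.exact_lsmul_mkQ_smul_top X r) hX'.1 (Submodule.mkQ_surjective _) h
    · intro h
      refine subsingleton_of_forall_eq 0 fun x => ?_
      obtain ⟨δ, hδ⟩ := exists_comp_extClass_of_mem_annihilator (hL r (by simp)) hX'.1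
      obtain ⟨y, rfl⟩ := hδ x
      rw [Subsingleton.elim y 0, Abelian.Ext.zero_comp]

theorem mkQ_mem_ofList_smul_top {r : R} {rs : List R} {x : X}
    (h : x ∈ (Ideal.ofList (r :: rs) • ⊤ : Submodule R X)) :
    (r • (⊤ : Submodule R X)).mkQ x ∈ (Ideal.ofList rs • ⊤ : Submodule R (QuotSMulTop r X)) := by
  have h1 := Submodule.mem_map_of_mem (f := (r • (⊤ : Submodule R X)).mkQ) h
  rwa [Ideal.ofList_cons_smul, Submodule.map_sup, Submodule.mkQ_map_self, bot_sup_eq,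
    Submodule.map_smul'', Submodule.map_top, Submodule.range_mkQ] at h1

theorem ext_length_smul_eq_zero (rs : List R) (hL : ∀ r ∈ rs, r ∈ Module.annihilator R L)
    (a : R) : ∀ (X : Type) [AddCommGroup X] [Module R X], IsWeaklyRegular X rs →
    (∀ x : X, a • x ∈ (Ideal.ofList rs • ⊤ : Submodule R X)) →
    ∀ x : Abelian.Ext (ModuleCat.of R L) (ModuleCat.of R X) rs.length, a • x = 0 := by
  induction rs with
  | nil =>
    intro X _ _ _ ha x
    have h : a • 𝟙 (ModuleCat.of R X) = 0 := by
      ext y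
      simpa using ha y
    rw [← Abelian.Ext.comp_mk₀_id x, ← Abelian.Ext.comp_smul, ← Abelian.Ext.mk₀_smul, h,
      Abelian.Ext.mk₀_zero, Abelian.Ext.comp_zero]
  | cons r rs ih =>
    intro X _ _ hX ha x
    rw [isWeaklyRegular_cons_iff] at hX
    obtain ⟨δ, hδ⟩ := exists_comp_extClass_of_mem_annihilator (hL r (by simp)) hX.1
    obtain ⟨y, rfl⟩ := hδ x
    rw [← Abelian.Ext.smul_comp, ih (fun r hr => hL r (by simp [hr])) _ hX.2 ?_ y,
      Abelian.Ext.zero_comp]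
    intro z
    obtain ⟨z, rfl⟩ := Submodule.mkQ_surjective _ z
    exact mkQ_mem_ofList_smul_top (ha z)

/-- If `Ext¹(M, A) = 0` and `r` is `A`-regular, then `Hom(M, A)/r ≅ Hom(M, A/r)`. -/
theorem exact_lsmul_compRight_mkQ {r : R} (hr : IsSMulRegular A r) :
    Function.Exact (LinearMap.lsmul R (M →ₗ[R] A) r)
      ((r • (⊤ : Submodule R A)).mkQ.compRight R : (M →ₗ[R] A) →ₗ[R] _) := by
  have hex := LinearMap.exact_lsmul_mkQ_smul_top A r
  have hinj : Function.Injective (LinearMap.lsmul R A r) := hr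
  intro φ
  constructor
  · intro h
    have h' : ∀ m, φ m ∈ (LinearMap.lsmul R A r).range := fun m =>
      (hex _).mp (LinearMap.congr_fun h m)
    refine ⟨(LinearEquiv.ofInjective _ hinj).symm.toLinearMap ∘ₗ φ.codRestrict _ h', ?_⟩
    ext m
    exact congrArg Subtype.val
      ((LinearEquiv.ofInjective _ hinj).apply_symm_apply (φ.codRestrict _ h' m))
  · rintro ⟨φ, rfl⟩
    ext m
    exact hex.apply_apply_eq_zero (φ m)

theorem range_lsmul_eq_smul_top (A : Type) [AddCommGroup A] [Module R A] (r : R) :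
    (LinearMap.lsmul R A r).range = r • (⊤ : Submodule R A) := by
  ext x
  simp [Submodule.mem_smul_pointwise_iff_exists]

theorem isWeaklyRegular_linearMap (rs : List R) :
    ∀ (A : Type) [AddCommGroup A] [Module R A], IsWeaklyRegular A rs →
    (∀ i, 1 ≤ i → i ≤ rs.length → ExtVanishes R i M A) →
    IsWeaklyRegular (M →ₗ[R] A) rs := by
  induction rs with
  | nil => intros; exact .nil _ _
  | cons r rs ih =>
    intro A _ _ hA h
    rw [isWeaklyRegular_cons_iff] at hA ⊢
    refine ⟨fun φ ψ hφ => LinearMap.ext fun m => hA.1 (LinearMap.congr_fun hφ m), ?_⟩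
    have hex := LinearMap.exact_lsmul_mkQ_smul_top A r
    let G : (M →ₗ[R] A) →ₗ[R] (M →ₗ[R] QuotSMulTop r A) :=
      (r • (⊤ : Submodule R A)).mkQ.compRight R
    have hG : Function.Surjective G :=
      (h 1 le_rfl (by simp)).exists_lift hex hA.1 (Submodule.mkQ_surjective _)
    have hker : r • (⊤ : Submodule R (M →ₗ[R] A)) = G.ker := by
      rw [← range_lsmul_eq_smul_top]
      exact ((exact_lsmul_compRight_mkQ hA.1).linearMap_ker_eq).symm
    refine (((Submodule.quotEquivOfEq _ _ hker).trans
      (G.quotKerEquivOfSurjective hG)).isWeaklyRegular_congr rs).mpr (ih _ hA.2 fun i h1 h2 => ?_)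
    exact (h i h1 (by simp; omega)).right_right hex hA.1 (Submodule.mkQ_surjective _)
      (h (i + 1) (by omega) (by simpa using h2))

theorem mem_ofList_smul_top_of_forall_apply_mem (rs : List R) :
    ∀ (A : Type) [AddCommGroup A] [Module R A], IsWeaklyRegular A rs →
    (∀ i, 1 ≤ i → i ≤ rs.length → ExtVanishes R i M A) →
    ∀ f : M →ₗ[R] A, (∀ m, f m ∈ (Ideal.ofList rs • ⊤ : Submodule R A)) →
    f ∈ (Ideal.ofList rs • ⊤ : Submodule R (M →ₗ[R] A)) := by
  induction rs with
  | nil =>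
    intro A _ _ _ _ f hf
    have : f = 0 := by
      ext m
      simpa using hf m
    simp [this]
  | cons r rs ih =>
    intro A _ _ hA h f hf
    rw [isWeaklyRegular_cons_iff] at hA
    have hex := LinearMap.exact_lsmul_mkQ_smul_top A r
    let G : (M →ₗ[R] A) →ₗ[R] (M →ₗ[R] QuotSMulTop r A) :=
      (r • (⊤ : Submodule R A)).mkQ.compRight R
    have hG : Function.Surjective G :=
      (h 1 le_rfl (by simp)).exists_lift hex hA.1 (Submodule.mkQ_surjective _)
    have h1 : G f ∈ (Ideal.ofList rs • ⊤ : Submodule R (M →ₗ[R] QuotSMulTop r A)) := by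
      refine ih _ hA.2 (fun i h1 h2 => ?_) (G f) fun m => ?_
      · exact (h i h1 (by simp; omega)).right_right hex hA.1 (Submodule.mkQ_surjective _)
          (h (i + 1) (by omega) (by simpa using h2))
      · exact mkQ_mem_ofList_smul_top (hf m)
    rw [← LinearMap.range_eq_top.mpr hG, ← Submodule.map_top, ← Submodule.map_smul''] at h1
    obtain ⟨f', hf', hff'⟩ := h1
    have h2 : f - f' ∈ G.ker := by rw [LinearMap.mem_ker, map_sub, hff', sub_self]
    rw [(exact_lsmul_compRight_mkQ hA.1).linearMap_ker_eq, range_lsmul_eq_smul_top] at h2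
    rw [Ideal.ofList_cons_smul]
    have := Submodule.add_mem_sup h2 hf'
    rwa [sub_add_cancel] at this

end

section

variable {K B D N : Type} [AddCommGroup K] [Module R K] [AddCommGroup B] [Module R B]
  [AddCommGroup D] [Module R D] [AddCommGroup N] [Module R N]

theorem ext_eq_zero_of_mk₀_comp_eq_zero {f : K →ₗ[R] B} {g : B →ₗ[R] D}
    (hfg : Function.Exact f g) (hf : Function.Injective f) (hg : Function.Surjective g) {n : ℕ}
    (h : ∀ i < n, ExtVanishes R i K N)
    (x : Abelian.Ext (ModuleCat.of R D) (ModuleCat.of R N) n)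
    (hx : (Abelian.Ext.mk₀ (ModuleCat.ofHom g)).comp x (zero_add n) = 0) : x = 0 := by
  cases n with
  | zero =>
    have : Epi (ModuleCat.ofHom g) := (ModuleCat.epi_iff_surjective _).mpr hg
    apply Abelian.Ext.precomp_mk₀_injective_of_epi (ModuleCat.of R N) (ModuleCat.ofHom g)
    simpa using hx
  | succ n =>
    obtain ⟨y, rfl⟩ := Abelian.Ext.contravariant_sequence_exact₃
      (shortExact_of_exact hfg hf hg) (ModuleCat.of R N) x hx (add_comm 1 n)
    have := h n n.lt_succ_self
    rw [Subsingleton.elim y 0, Abelian.Ext.comp_zero]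

theorem ExtVanishes.of_surjective {f : K →ₗ[R] B} {g : B →ₗ[R] D}
    (hfg : Function.Exact f g) (hf : Function.Injective f) (hg : Function.Surjective g) {n : ℕ}
    (h : ∀ i < n, ExtVanishes R i K N) (hB : ExtVanishes R n B N) : ExtVanishes R n D N :=
  subsingleton_of_forall_eq 0 fun x =>
    ext_eq_zero_of_mk₀_comp_eq_zero hfg hf hg h x (Subsingleton.elim _ _)

theorem extVanishes_of_quotSMulTop [IsNoetherianRing R] [IsLocalRing R] [Module.Finite R B]
    [Module.Finite R N] {r : R} (hr : r ∈ IsLocalRing.maximalIdeal R) (hB : IsSMulRegular B r)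
    {i : ℕ} (h : ExtVanishes R (i + 1) (QuotSMulTop r B) N) : ExtVanishes R i B N := by
  have key : ∀ x : Abelian.Ext (ModuleCat.of R B) (ModuleCat.of R N) i, ∃ y, r • y = x := by
    intro x
    obtain ⟨y, hy⟩ := Abelian.Ext.contravariant_sequence_exact₁
      (shortExact_of_exact (LinearMap.exact_lsmul_mkQ_smul_top B r) hB
        (Submodule.mkQ_surjective _)) (ModuleCat.of R N) x (add_comm 1 i) (h.elim _ _)
    have h' : (Abelian.Ext.mk₀ (r • 𝟙 (ModuleCat.of R B))).comp y (zero_add _) = x := hy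
    refine ⟨y, ?_⟩
    rw [← h', Abelian.Ext.mk₀_smul, Abelian.Ext.smul_comp, Abelian.Ext.mk₀_id_comp]
  have : (⊤ : Submodule R (Abelian.Ext (ModuleCat.of R B) (ModuleCat.of R N) i)) = ⊥ := by
    refine Submodule.eq_bot_of_le_smul_of_le_jacobson_bot (IsLocalRing.maximalIdeal R) ⊤
      Module.Finite.fg_top (fun x _ => ?_) (IsLocalRing.maximalIdeal_le_jacobson _)
    obtain ⟨y, rfl⟩ := key x
    exact Submodule.smul_mem_smul hr trivial
  exact (Submodule.subsingleton_iff R).mp (subsingleton_of_bot_eq_top this.symm)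

theorem extVanishes_of_forall_prime [IsNoetherianRing R] {i : ℕ}
    (h : ∀ p : Ideal R, p.IsPrime → ExtVanishes R i (R ⧸ p) N) (L : Type) [AddCommGroup L]
    [Module R L] [Module.Finite R L] : ExtVanishes R i L N := by
  refine IsNoetherianRing.induction_on_isQuotientEquivQuotientPrime R (M := L)
    ‹Module.Finite R L› (motive := fun L _ _ _ => ExtVanishes R i L N) ?_ ?_ ?_
  · intro L _ _ _ _
    refine subsingleton_of_forall_eq 0 fun x => ?_
    have h0 : 𝟙 (ModuleCat.of R L) = 0 := by ext l; exact Subsingleton.elim _ _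
    rw [← Abelian.Ext.mk₀_id_comp x, h0, Abelian.Ext.mk₀_zero, Abelian.Ext.zero_comp]
  · intro L _ _ _ p e
    exact (h p.1 p.2).congr_left e.symm
  · intro _ _ _ _ _ _ _ _ _ _ _ _ f g hf hg hfg h1 h3
    exact h1.middle_left hfg hf hg h3

end

end RegularSequences

section LocalRings

open RingTheory.Sequence IsLocalRing

variable {R : Type} [CommRing R]

theorem exists_quotient_embedding {I J : Ideal R} {s : R} (hI : I.IsMaximal) (hs : s ∉ J)
    (h : ∀ r ∈ I, r * s ∈ J) :
    ∃ ι : (R ⧸ I) →ₗ[R] (R ⧸ J), Function.Injective ι ∧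
      ∀ r, ι (Submodule.Quotient.mk r) = Submodule.Quotient.mk (r * s) := by
  have h' : I ≤ Submodule.comap (LinearMap.mulRight R s) J := h
  refine ⟨Submodule.mapQ I J (LinearMap.mulRight R s) h', ?_, fun r => rfl⟩
  rw [← LinearMap.ker_eq_bot, Submodule.eq_bot_iff]
  intro x hx
  obtain ⟨r, rfl⟩ := Submodule.Quotient.mk_surjective _ x
  rw [LinearMap.mem_ker, Submodule.mapQ_apply, Submodule.Quotient.mk_eq_zero] at hx
  rw [Submodule.Quotient.mk_eq_zero]
  by_contra hr
  obtain ⟨y, i, hi, hyi⟩ := hI.exists_inv hr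
  apply hs
  have : s = y * (r * s) + i * s := by rw [← mul_assoc, ← add_mul, hyi, one_mul]
  rw [this]
  exact J.add_mem (J.mul_mem_left y hx) (h i hi)

theorem smul_top_lt_top {I : Ideal R} (hI : I ≠ ⊤) : I • (⊤ : Submodule R R) < ⊤ := by
  rwa [smul_eq_mul, Ideal.mul_top, lt_top_iff_ne_top]

theorem extVanishes_quotient_ofList_of_lt {N : Type} [AddCommGroup N] [Module R N] (rs : List R)
    (n : ℕ) : ∀ (B : Type) [AddCommGroup B] [Module R B], IsWeaklyRegular B rs →
    (∀ i, n < i → ExtVanishes R i B N) →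
    ∀ i, n + rs.length < i → ExtVanishes R i (B ⧸ (Ideal.ofList rs • ⊤ : Submodule R B)) N := by
  induction rs generalizing n with
  | nil =>
    intro B _ _ _ h i hi
    exact (h i hi).congr_left (Submodule.quotEquivOfEqBot _ (by simp)).symm
  | cons r rs ih =>
    intro B _ _ hB h i hi
    rw [isWeaklyRegular_cons_iff] at hB
    refine (ih (n + 1) _ hB.2 (fun i hi => ?_) i (by simp at hi; omega)).congr_left
      (Submodule.quotOfListConsSMulTopEquivQuotSMulTopInner B r rs).symm
    obtain ⟨i, rfl⟩ : ∃ j, i = j + 1 := ⟨i - 1, by omega⟩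
    exact (h i (by omega)).right_left (LinearMap.exact_lsmul_mkQ_smul_top B r) hB.1
      (Submodule.mkQ_surjective _) (h (i + 1) (by omega))

variable [IsNoetherianRing R] [IsLocalRing R]

/-- The maximal ideal contains a regular sequence whose length is the first degree in which
`Ext(R/𝔪, R)` does not vanish, and this length is at most the dimension. -/
theorem exists_isRegular_not_extVanishes {d : ℕ} (hd : ringKrullDim R = d) :
    ∃ rs : List R, IsRegular R rs ∧ (∀ r ∈ rs, r ∈ maximalIdeal R) ∧ rs.length ≤ d ∧
      (∀ i < rs.length, ExtVanishes R i (R ⧸ maximalIdeal R) R) ∧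
      ¬ ExtVanishes R rs.length (R ⧸ maximalIdeal R) R := by
  have key : ∀ n : ℕ, (∀ i < n, ExtVanishes R i (R ⧸ maximalIdeal R) R) →
      ∃ rs : List R, IsRegular R rs ∧ (∀ r ∈ rs, r ∈ maximalIdeal R) ∧ rs.length ≤ d ∧
        rs.length = n := by
    intro n hn
    obtain ⟨rs, h1, h2, h3⟩ := ModuleCat.exists_isRegular_of_exists_subsingleton_ext
      (maximalIdeal R) n (ModuleCat.of R R)
      (smul_top_lt_top Ideal.IsPrime.ne_top')
      (ModuleCat.of R (R ⧸ maximalIdeal R))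
      (by
        have := Module.support_eq_zeroLocus (R := R) (M := R ⧸ maximalIdeal R)
        rwa [Ideal.annihilator_quotient] at this) hn
    have h4 := ringKrullDim_add_length_eq_ringKrullDim_of_isRegular rs h3
    have : Nontrivial (R ⧸ Ideal.ofList rs) := by
      refine Ideal.Quotient.nontrivial_iff.mpr fun h => h3.top_ne_smul ?_
      change ⊤ = Ideal.ofList rs • (⊤ : Ideal R)
      rw [smul_eq_mul, h, Ideal.mul_top]
    have h5 : (rs.length : WithBot ℕ∞) ≤ d := by
      rw [← hd, ← h4]
      exact le_add_of_nonneg_left ringKrullDim_nonneg_of_nontrivial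
    exact ⟨rs, h3, h2, by exact_mod_cast h5, h1⟩
  have hex : ∃ i, ¬ ExtVanishes R i (R ⧸ maximalIdeal R) R := by
    by_contra! h
    obtain ⟨rs, -, -, h1, h2⟩ := key (d + 1) fun i _ => h i
    omega
  classical
  obtain ⟨rs, h1, h2, h3, h4⟩ := key (Nat.find hex) fun i hi => not_not.mp (Nat.find_min hex hi)
  refine ⟨rs, h1, h2, h3, ?_, ?_⟩
  · rw [h4]
    exact fun i hi => not_not.mp (Nat.find_min hex hi)
  · rw [h4]
    exact Nat.find_spec hex

theorem nontrivial_dual {M : Type} [AddCommGroup M] [Module R M] [Module.Finite R M]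
    [Nontrivial M] {t : ℕ} (h : ∀ i, 1 ≤ i → i ≤ t → ExtVanishes R i M R)
    (ht : ¬ ExtVanishes R t (R ⧸ maximalIdeal R) R) : Nontrivial (M →ₗ[R] R) := by
  by_contra hN
  rw [not_nontrivial_iff_subsingleton, ← extVanishes_zero_iff] at hN
  have hle : Module.annihilator R M ≤ maximalIdeal R := by
    refine le_maximalIdeal fun h => ?_
    rw [Module.annihilator_eq_top_iff] at h
    exact not_nontrivial M inferInstance
  obtain ⟨rs, h1, h2, h3⟩ := ModuleCat.exists_isRegular_of_exists_subsingleton_ext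
    (Module.annihilator R M) (t + 1) (ModuleCat.of R R)
    (smul_top_lt_top fun h => (maximalIdeal.isMaximal R).ne_top (top_le_iff.mp (h ▸ hle)))
    (ModuleCat.of R M) Module.support_eq_zeroLocus (fun i hi => by
      rcases Nat.eq_zero_or_pos i with rfl | hi'
      · exact hN
      · exact h i hi' (by omega))
  exact ht (extVanishes_of_lt_length rs (fun r hr => by
    rw [Ideal.annihilator_quotient]
    exact hle (h2 r hr)) R h3.toIsWeaklyRegular t (by omega))

variable {X : Type} [AddCommGroup X] [Module R X] [Module.Finite R X]

theorem extVanishes_quotient_prime_of_ne {p : Ideal R} (hp : p.IsPrime)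
    (hne : p ≠ maximalIdeal R) {i : ℕ}
    (h : ∀ (L : Type) [AddCommGroup L] [Module R L] [Module.Finite R L],
      ExtVanishes R (i + 1) L X) : ExtVanishes R i (R ⧸ p) X := by
  obtain ⟨r, hr, hrp⟩ := SetLike.exists_of_lt (lt_of_le_of_ne (le_maximalIdeal hp.ne_top) hne)
  refine extVanishes_of_quotSMulTop hr (fun x y hxy => ?_) (h _)
  obtain ⟨x, rfl⟩ := Submodule.Quotient.mk_surjective _ x
  obtain ⟨y, rfl⟩ := Submodule.Quotient.mk_surjective _ y
  simp only [← Submodule.Quotient.mk_smul, Submodule.Quotient.eq, smul_eq_mul, ← mul_sub]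
    at hxy ⊢
  exact (hp.mem_or_mem hxy).resolve_left hrp

theorem extVanishes_of_residue {i : ℕ} (hk : ExtVanishes R i (R ⧸ maximalIdeal R) X)
    (h : ∀ (L : Type) [AddCommGroup L] [Module R L] [Module.Finite R L],
      ExtVanishes R (i + 1) L X) (L : Type) [AddCommGroup L] [Module R L] [Module.Finite R L] :
    ExtVanishes R i L X := by
  refine extVanishes_of_forall_prime (fun p hp => ?_) L
  by_cases hpm : p = maximalIdeal R
  · rw [hpm]
    exact hk
  · exact extVanishes_quotient_prime_of_ne hp hpm h

theorem extVanishes_of_length_lt {rs : List R} (hrs : IsWeaklyRegular R rs) {s : R}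
    (hs : s ∉ Ideal.ofList rs) (hms : ∀ r ∈ maximalIdeal R, r * s ∈ Ideal.ofList rs) {n : ℕ}
    (hX : ∀ (L : Type) [AddCommGroup L] [Module R L] (i : ℕ), n < i → ExtVanishes R i L X) :
    ∀ i, rs.length < i → ∀ (L : Type) [AddCommGroup L] [Module R L] [Module.Finite R L],
      ExtVanishes R i L X := by
  have hS : ∀ i, rs.length < i → ExtVanishes R i (R ⧸ Ideal.ofList rs) X := by
    intro i hi
    have := extVanishes_quotient_ofList_of_lt (N := X) rs 0 R hrs (fun i hi => by
      obtain ⟨i, rfl⟩ : ∃ j, i = j + 1 := ⟨i - 1, by omega⟩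
      exact .of_projective i) i (by omega)
    rwa [smul_eq_mul, Ideal.mul_top] at this
  obtain ⟨ι, hι, -⟩ := exists_quotient_embedding (maximalIdeal.isMaximal R) hs hms
  have key : ∀ m i, n < i + m → rs.length < i →
      ∀ (L : Type) [AddCommGroup L] [Module R L] [Module.Finite R L], ExtVanishes R i L X := by
    intro m
    induction m with
    | zero => exact fun i hi _ L _ _ _ => hX L i hi
    | succ m ih =>
      intro i h1 h2
      have h3 := ih (i + 1) (by omega) (by omega)
      exact extVanishes_of_residue ((hS i h2).left_left ι.exact_map_mkQ_range hι
        (Submodule.mkQ_surjective _) (h3 _)) h3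
  exact fun i hi => key (n + 1) i (by omega) hi

end LocalRings

section Main

open RingTheory.Sequence IsLocalRing

variable {R : Type} [CommRing R]

theorem mem_annihilator_quotient_ofList {rs : List R} {r : R} (hr : r ∈ rs) :
    r ∈ Module.annihilator R (R ⧸ Ideal.ofList rs) := by
  rw [Ideal.annihilator_quotient]
  exact Ideal.subset_span hr

variable [IsLocalRing R]

theorem ringKrullDim_quotient_eq_zero_of_forall_prime {J : Ideal R} (hJ : J ≤ maximalIdeal R)
    (h : ∀ p : Ideal R, p.IsPrime → J ≤ p → p = maximalIdeal R) : ringKrullDim (R ⧸ J) = 0 := by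
  have : Nontrivial (R ⧸ J) := Ideal.Quotient.nontrivial_iff.mpr fun h =>
    (maximalIdeal.isMaximal R).ne_top (top_le_iff.mp (h ▸ hJ))
  rw [← ringKrullDimZero_iff_ringKrullDim_eq_zero]
  refine Ring.krullDimLE_zero_iff.mpr fun p hp => ?_
  refine Ideal.isMaximal_of_isIntegral_of_isMaximal_comap (R := R) _ ?_
  have := hp.comap (Ideal.Quotient.mk J)
  convert! maximalIdeal.isMaximal R
  exact h _ this (.trans (by simp) (Ideal.ker_le_comap _))

theorem exists_smul_notMem_of_not_extVanishes {rs : List R} (hrs : IsWeaklyRegular R rs)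
    (hmem : ∀ r ∈ rs, r ∈ maximalIdeal R)
    (h : ¬ ExtVanishes R rs.length (R ⧸ maximalIdeal R) R) :
    ∃ s ∉ Ideal.ofList rs, ∀ r ∈ maximalIdeal R, r * s ∈ Ideal.ofList rs := by
  rw [extVanishes_length_iff rs (fun r hr => by
      rw [Ideal.annihilator_quotient]
      exact hmem r hr) R hrs, smul_eq_mul, Ideal.mul_top] at h
  by_contra! hs
  refine h (subsingleton_of_forall_eq 0 fun φ => ?_)
  obtain ⟨s, hs'⟩ := Submodule.Quotient.mk_surjective _ (φ (Submodule.Quotient.mk 1))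
  have hmul : ∀ r, φ (Submodule.Quotient.mk r) = Submodule.Quotient.mk (r * s) := by
    intro r
    rw [← smul_eq_mul, Submodule.Quotient.mk_smul, hs', ← map_smul, ← Submodule.Quotient.mk_smul,
      smul_eq_mul, mul_one]
  have hsJ : s ∈ Ideal.ofList rs := by
    by_contra hsJ
    obtain ⟨r, hr, hrs⟩ := hs s hsJ
    apply hrs
    rw [← Submodule.Quotient.mk_eq_zero, ← hmul, (Submodule.Quotient.mk_eq_zero _).mpr hr, map_zero]
  refine LinearMap.ext fun x => ?_
  obtain ⟨r, rfl⟩ := Submodule.Quotient.mk_surjective _ x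
  rw [hmul, LinearMap.zero_apply, Submodule.Quotient.mk_eq_zero]
  exact Ideal.mul_mem_left _ _ hsJ

variable {X : Type} [AddCommGroup X] [Module R X]

theorem exists_ext_smul_ne_zero {rs : List R} (hmem : ∀ r ∈ rs, r ∈ maximalIdeal R)
    (hX : IsWeaklyRegular X rs)
    (h : ∀ (L : Type) [AddCommGroup L] [Module R L] [Module.Finite R L],
      ExtVanishes R (rs.length + 1) L X)
    (hk : ¬ ExtVanishes R rs.length (R ⧸ maximalIdeal R) X) {s : R}
    (hs : s ∉ Ideal.ofList rs) (hms : ∀ r ∈ maximalIdeal R, r * s ∈ Ideal.ofList rs) :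
    ∃ x : Abelian.Ext (ModuleCat.of R (R ⧸ Ideal.ofList rs)) (ModuleCat.of R X) rs.length,
      s • x ≠ 0 := by
  obtain ⟨e, he⟩ : ∃ e : Abelian.Ext (ModuleCat.of R (R ⧸ maximalIdeal R)) (ModuleCat.of R X)
      rs.length, e ≠ 0 := by
    by_contra! he
    exact hk (subsingleton_of_forall_eq 0 he)
  obtain ⟨ι, hι, hιs⟩ := exists_quotient_embedding (maximalIdeal.isMaximal R) hs hms
  obtain ⟨x, hx⟩ := Abelian.Ext.contravariant_sequence_exact₁
    (shortExact_of_exact ι.exact_map_mkQ_range hι (Submodule.mkQ_surjective _))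
    (ModuleCat.of R X) e (add_comm 1 rs.length) ((h _).elim _ _)
  have hx : (Abelian.Ext.mk₀ (ModuleCat.ofHom ι)).comp x (zero_add _) = e := hx
  refine ⟨x, fun hsx => he ?_⟩
  have hle : Ideal.ofList rs ≤ maximalIdeal R := Ideal.span_le.mpr hmem
  let π : (R ⧸ Ideal.ofList rs) →ₗ[R] (R ⧸ maximalIdeal R) := Submodule.factor hle
  have hπ : s • 𝟙 (ModuleCat.of R (R ⧸ Ideal.ofList rs)) =
      ModuleCat.ofHom π ≫ ModuleCat.ofHom ι := by
    refine ModuleCat.hom_ext (LinearMap.ext fun y => ?_)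
    obtain ⟨r, rfl⟩ := Submodule.Quotient.mk_surjective _ y
    exact (congrArg _ (mul_comm s r)).trans (hιs r).symm
  refine ext_eq_zero_of_mk₀_comp_eq_zero π.exact_subtype_ker_map π.ker.injective_subtype
    (Submodule.factor_surjective hle) (fun i hi => extVanishes_of_lt_length rs (fun r hr => ?_) X
      hX i hi) e ?_
  · exact LinearMap.annihilator_le_of_injective _ π.ker.injective_subtype
      (mem_annihilator_quotient_ofList hr)
  · rw [← hx, ← Abelian.Ext.comp_assoc_of_second_deg_zero, Abelian.Ext.mk₀_comp_mk₀, ← hπ,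
      Abelian.Ext.mk₀_smul, Abelian.Ext.smul_comp, Abelian.Ext.mk₀_id_comp, hsx]

variable [IsNoetherianRing R] [Module.Finite R X]

theorem not_extVanishes_length [Nontrivial X] {rs : List R}
    (hmem : ∀ r ∈ rs, r ∈ maximalIdeal R) (hX : IsWeaklyRegular X rs)
    (h : ∀ (L : Type) [AddCommGroup L] [Module R L] [Module.Finite R L],
      ExtVanishes R (rs.length + 1) L X) :
    ¬ ExtVanishes R rs.length (R ⧸ maximalIdeal R) X := by
  intro hk
  have hS := extVanishes_of_residue hk h (R ⧸ Ideal.ofList rs)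
  rw [extVanishes_length_iff rs (fun r hr => mem_annihilator_quotient_ofList hr) X hX] at hS
  apply (IsRegular.of_isWeaklyRegular_of_mem_maximalIdeal X hmem hX).top_ne_smul
  refine (Submodule.eq_top_iff'.mpr fun x => ?_).symm
  let φ : (R ⧸ Ideal.ofList rs) →ₗ[R] X ⧸ (Ideal.ofList rs • ⊤ : Submodule R X) :=
    Submodule.liftQ _ (LinearMap.toSpanSingleton R _ (Submodule.Quotient.mk x)) fun r hr => by
      rw [LinearMap.mem_ker, LinearMap.toSpanSingleton_apply, ← Submodule.Quotient.mk_smul,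
        Submodule.Quotient.mk_eq_zero]
      exact Submodule.smul_mem_smul hr trivial
  have h1 : φ (Submodule.Quotient.mk 1) = 0 := by rw [hS.elim φ 0, LinearMap.zero_apply]
  rw [← Submodule.Quotient.mk_eq_zero, ← h1, Submodule.liftQ_apply,
    LinearMap.toSpanSingleton_apply, one_smul]

theorem eq_maximalIdeal_of_ofList_le {rs : List R} (hX : IsWeaklyRegular X rs)
    (h : ∀ (L : Type) [AddCommGroup L] [Module R L] [Module.Finite R L],
      ExtVanishes R (rs.length + 1) L X)
    (hk : ¬ ExtVanishes R rs.length (R ⧸ maximalIdeal R) X) {p : Ideal R} (hp : p.IsPrime)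
    (hle : Ideal.ofList rs ≤ p) : p = maximalIdeal R := by
  by_contra hne
  have hpm : p ≤ maximalIdeal R := le_maximalIdeal hp.ne_top
  let g : (R ⧸ p) →ₗ[R] (R ⧸ maximalIdeal R) := Submodule.factor hpm
  refine hk (ExtVanishes.of_surjective g.exact_subtype_ker_map g.ker.injective_subtype
    (Submodule.factor_surjective hpm) (fun i hi => extVanishes_of_lt_length rs (fun r hr => ?_) X
      hX i hi) (extVanishes_quotient_prime_of_ne hp hne h))
  refine LinearMap.annihilator_le_of_injective _ g.ker.injective_subtype ?_
  rw [Ideal.annihilator_quotient]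
  exact hle (Ideal.subset_span hr)

variable {C M : Type} [AddCommGroup C] [Module R C] [Module.Finite R C]
  [AddCommGroup M] [Module R M] [Module.Finite R M]

theorem depth_and_exists_surjective_of_dual [Nontrivial M] {d : ℕ} (hd : ringKrullDim R = d)
    (hC : IsSemidualizing R C) {n : ℕ}
    (hX : ∀ (L : Type) [AddCommGroup L] [Module R L] (i : ℕ), n < i →
      ExtVanishes R i L (TensorProduct R C (M →ₗ[R] R)))
    (hM : ∀ i, 1 ≤ i → i ≤ d → ExtVanishes R i M R) :
    ((∀ i < d, ExtVanishes R i (R ⧸ maximalIdeal R) R) ∧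
      ¬ ExtVanishes R d (R ⧸ maximalIdeal R) R) ∧
    ∃ f : M →ₗ[R] R, Function.Surjective f := by
  obtain ⟨rs, hrs, hmem, hle, hlt, hnot⟩ := exists_isRegular_not_extVanishes hd
  have hM' : ∀ i, 1 ≤ i → i ≤ rs.length → ExtVanishes R i M R := fun i h1 h2 =>
    hM i h1 (h2.trans hle)
  have hN : Nontrivial (M →ₗ[R] R) := nontrivial_dual hM' hnot
  have : Nontrivial (TensorProduct R C (M →ₗ[R] R)) := by
    by_contra h
    rw [not_nontrivial_iff_subsingleton] at h
    exact not_subsingleton (M →ₗ[R] R)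
      (subsingleton_of_subsingleton_tensorProduct hC.bijective.1)
  have hXrs : IsWeaklyRegular (TensorProduct R C (M →ₗ[R] R)) rs :=
    ((hC.isBass_of_extVanishes n _ hX).isAuslander hC).isWeaklyRegular_tensorProduct hC rs _
      (isWeaklyRegular_linearMap rs R hrs.toIsWeaklyRegular hM')
  obtain ⟨s, hs, hms⟩ := exists_smul_notMem_of_not_extVanishes hrs.toIsWeaklyRegular hmem hnot
  have htop : ∀ (L : Type) [AddCommGroup L] [Module R L] [Module.Finite R L],
      ExtVanishes R (rs.length + 1) L (TensorProduct R C (M →ₗ[R] R)) :=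
    extVanishes_of_length_lt hrs.toIsWeaklyRegular hs hms hX _ (Nat.lt_succ_self _)
  have hk := not_extVanishes_length hmem hXrs htop
  have hdim := ringKrullDim_add_length_eq_ringKrullDim_of_isRegular rs hrs
  have hJ : Ideal.ofList rs ≤ maximalIdeal R := Ideal.span_le.mpr hmem
  rw [ringKrullDim_quotient_eq_zero_of_forall_prime hJ fun p hp hp' =>
    eq_maximalIdeal_of_ofList_le hXrs htop hk hp hp', hd, zero_add] at hdim
  obtain rfl : rs.length = d := by exact_mod_cast hdim
  refine ⟨⟨hlt, hnot⟩, ?_⟩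
  by_contra! hsurj
  have hrange : ∀ (f : M →ₗ[R] R) (m : M), f m ∈ maximalIdeal R := by
    intro f m
    by_contra hm
    refine hsurj f fun r => ?_
    obtain ⟨u, hu⟩ := notMem_maximalIdeal.mp hm
    exact ⟨(r * (u⁻¹ : Rˣ)) • m, by
      rw [map_smul, smul_eq_mul, ← hu, mul_assoc, Units.inv_mul, mul_one]⟩
  have hsN : ∀ f : M →ₗ[R] R, s • f ∈ (Ideal.ofList rs • ⊤ : Submodule R (M →ₗ[R] R)) := by
    intro f
    refine mem_ofList_smul_top_of_forall_apply_mem rs R hrs.toIsWeaklyRegular hM _ fun m => ?_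
    rw [smul_eq_mul, Ideal.mul_top, LinearMap.smul_apply, smul_eq_mul, mul_comm]
    exact hms _ (hrange f m)
  have hsX : ∀ x : TensorProduct R C (M →ₗ[R] R),
      s • x ∈ (Ideal.ofList rs • ⊤ : Submodule R (TensorProduct R C (M →ₗ[R] R))) := by
    intro x
    induction x with
    | zero => rw [smul_zero]; exact Submodule.zero_mem _
    | add x y hx hy => rw [smul_add]; exact Submodule.add_mem _ hx hy
    | tmul c f =>
      rw [← TensorProduct.tmul_smul]
      have h1 := Submodule.mem_map_of_mem (f := TensorProduct.mk R C (M →ₗ[R] R) c) (hsN f)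
      rw [Submodule.map_smul''] at h1
      exact Submodule.smul_mono le_rfl le_top h1
  obtain ⟨x, hx⟩ := exists_ext_smul_ne_zero hmem hXrs htop hk hs hms
  exact hx (ext_length_smul_eq_zero rs (fun r hr => mem_annihilator_quotient_ofList hr) s _ hXrs
    hsX x)

end Main

section Main

open IsLocalRing

variable {R : Type} [CommRing R]

theorem subsingleton_extMod_iff_s12 (i : ℕ) {M N : Type} [AddCommGroup M] [Module R M]
    [AddCommGroup N] [Module R N] : Subsingleton (extMod R i M N) ↔ ExtVanishes R i M N := by
  cases i with
  | zero => rw [subsingleton_extMod_zero_iff, extVanishes_zero_iff]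
  | succ i => exact subsingleton_extMod_succ_iff i

theorem ExtVanishes.retract_tensorProduct {i : ℕ} {C L A B : Type} [AddCommGroup C] [Module R C]
    [AddCommGroup L] [Module R L] [AddCommGroup A] [Module R A] [AddCommGroup B] [Module R B]
    (h : ExtVanishes R i L (TensorProduct R C B)) (f : A →ₗ[R] B) (g : B →ₗ[R] A)
    (hgf : g ∘ₗ f = LinearMap.id) : ExtVanishes R i L (TensorProduct R C A) :=
  h.retract_right (f.lTensor C) (g.lTensor C) (by
    rw [← LinearMap.lTensor_comp, hgf, LinearMap.lTensor_id])

variable [IsNoetherianRing R] [IsLocalRing R] {C M : Type} [AddCommGroup C] [Module R C]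
  [Module.Finite R C] [AddCommGroup M] [Module R M] [Module.Finite R M]

theorem exists_surjective_pi_succ {d : ℕ} (hd : ringKrullDim R = d) (hC : IsSemidualizing R C)
    {n : ℕ} (hX : ∀ (L : Type) [AddCommGroup L] [Module R L] (i : ℕ), n < i →
      ExtVanishes R i L (TensorProduct R C (M →ₗ[R] R)))
    (hM : ∀ i, 1 ≤ i → i ≤ d → ExtVanishes R i M R) {r : ℕ} (p : M →ₗ[R] (Fin r → R))
    (hp : Function.Surjective p) (hpi : ¬ Function.Injective p) :
    ∃ p' : M →ₗ[R] (Fin (r + 1) → R), Function.Surjective p' := by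
  obtain ⟨σ, hσ⟩ := Module.projective_lifting_property p LinearMap.id hp
  have hσ' : ∀ v, p (σ v) = v := LinearMap.congr_fun hσ
  let q : M →ₗ[R] p.ker := (LinearMap.id - σ ∘ₗ p).codRestrict _ fun m => by simp [hσ']
  have hq : q ∘ₗ p.ker.subtype = LinearMap.id := by
    ext k
    have hk : p k = 0 := k.2
    simp [q, hk]
  have hq' : ∀ k : p.ker, q k = k := LinearMap.congr_fun hq
  have : Nontrivial p.ker := by
    rwa [Submodule.nontrivial_iff_ne_bot, Ne, LinearMap.ker_eq_bot]
  obtain ⟨-, f, hf⟩ := depth_and_exists_surjective_of_dual (M := p.ker) (n := n) hd hC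
    (fun L _ _ i hi => (hX L i hi).retract_tensorProduct (LinearMap.lcomp R R q)
      (LinearMap.lcomp R R p.ker.subtype) (by
        ext φ k
        exact congrArg φ (hq' k)))
    (fun i h1 h2 => (hM i h1 h2).retract_left p.ker.subtype q hq)
  refine ⟨LinearMap.pi (Fin.cons (f ∘ₗ q) fun j => LinearMap.proj j ∘ₗ p), fun v => ?_⟩
  obtain ⟨k, hk⟩ := hf (v 0)
  have hpk : p k = 0 := k.2
  refine ⟨σ (Fin.tail v) - q (σ (Fin.tail v)) + k, ?_⟩
  have hpq : p (q (σ (Fin.tail v))) = 0 := (q _).2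
  ext j
  refine Fin.cases ?_ (fun j => ?_) j
  · simp [hq', hk]
  · simp [hσ', hpk, hpq, Fin.tail]

end Main

theorem cm_canonical_free_of_finite_C_injdim_dual
    (R : Type) [CommRing R] [IsNoetherianRing R] [IsLocalRing R]
    (d : ℕ) (hd : ringKrullDim R = d)
    (C : Type) [AddCommGroup C] [Module R C] [Module.Finite R C]
    (hC : IsSemidualizing R C)
    (M : Type) [AddCommGroup M] [Module R M] [Module.Finite R M] [Nontrivial M]
    (hCinj : HasFiniteInjDim R (TensorProduct R C (M →ₗ[R] R)))
    (hextR : ∀ i : ℕ, 1 ≤ i → i ≤ d → Subsingleton (extMod R i M R)) :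
    moduleDepth R R = d ∧ HasFiniteInjDim R C ∧ Module.Free R M := by
  obtain ⟨n, hn⟩ := hCinj
  simp only [subsingleton_extMod_iff_s12] at hn hextR
  obtain ⟨⟨hlt, hnot⟩, f, hf⟩ := depth_and_exists_surjective_of_dual hd hC hn hextR
  refine ⟨?_, ⟨n, fun L _ _ i hi => ?_⟩, ?_⟩
  · simp only [moduleDepth, subsingleton_extMod_iff_s12]
    refine le_antisymm (Nat.sInf_le hnot) (le_csInf ⟨d, hnot⟩ fun i hi => ?_)
    by_contra! h
    exact hi (hlt i h)
  · obtain ⟨m, hm⟩ := hf 1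
    rw [subsingleton_extMod_iff_s12]
    exact ((hn L i hi).retract_tensorProduct (LinearMap.toSpanSingleton R _ f)
      (LinearMap.applyₗ m) (by ext; simp [hm])).congr_right (TensorProduct.rid R C)
  · by_contra hfree
    have key : ∀ r : ℕ, ∃ p : M →ₗ[R] (Fin r → R), Function.Surjective p := by
      intro r
      induction r with
      | zero => exact ⟨0, fun v => ⟨0, Subsingleton.elim _ _⟩⟩
      | succ r ih =>
        obtain ⟨p, hp⟩ := ih
        exact exists_surjective_pi_succ hd hC hn hextR p hp fun hpi =>
          hfree (Module.Free.of_equiv (LinearEquiv.ofBijective p ⟨hpi, hp⟩).symm)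
    obtain ⟨k, g, hg⟩ := Module.Finite.exists_fin' R M
    obtain ⟨p, hp⟩ := key (k + 1)
    have := card_le_of_surjective R (p ∘ₗ g) (hp.comp hg)
    simp at this
end
end
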